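/- arXiv:1502.01359 — 2 statements merged into one kernel-verified Lean document; each statement's English description precedes it below -/
import Mathlib

section
/- (Inner bound for the cooperative Berger–Tung problem with side information.) Fix a pmf p on 𝒳1×𝒳2×𝒳3×𝒰1×𝒰2×𝒱1×𝒱2 (all finite) satisfying the Markov chains U1 −∘− (X1,V1) −∘− (X2,X3,V2) and U2 −∘− (U1,X2,V1) −∘− (X1,X3,V2). For each n let (X1^n,X2^n,X3^n,V1^n,V2^n) be random vectors with an arbitrary joint law (not necessarily i.i.d.) such that for every ε>0, Pr{(X1^n,X2^n,X3^n,V1^n,V2^n) ∈ T^n_{[X1X2X3V1V2]ε}} → 1 as n → ∞. If R1 > I(X1;U1|X2,V1), R2 > I(X2;U2|X3,V1,V2,U1) and R1+R2 > I(X1,X2;U1,U2|X3,V1,V2) (all mutual informations computed under p), then (R1,R2) is achievable: for every ε>0 there exist n and a cooperative Berger–Tung code with (1/n)log2|ℳ_i| ≤ R_i+ε (i=1,2) whose output (Û1^n,Û2^n) = g(X3^n,V1^n,V2^n,M1,M2), where M1 = f1(X1^n,V1^n) and M2 = f2(X2^n,V1^n,M1), satisfies Pr{(Û1^n,Û2^n,V1^n,V2^n,X1^n,X2^n,X3^n)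 ∉ T^n_{[U1U2V1V2X1X2X3]ε}} ≤ ε. -/
noncomputable section

namespace IT

variable {Ω : Type*} [Fintype Ω]

open Classical in
/-- Probability of an event under a weight function on a finite sample space. -/
def pr (w : Ω → ℝ) (E : Ω → Prop) : ℝ := ∑ ω, if E ω then w ω else 0

open Classical in
/-- The distribution (pmf) of a random variable. -/
def dist (w : Ω → ℝ) {α : Type*} [Fintype α] (X : Ω → α) (a : α) : ℝ :=
  ∑ ω, if X ω = a then w ω else 0

/-- Shannon entropy (base 2). -/
def H (w : Ω → ℝ) {α : Type*} [Fintype α] (X : Ω → α) : ℝ :=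
  -∑ a, dist w X a * Real.logb 2 (dist w X a)

/-- Conditional entropy H(X|Y). -/
def condH (w : Ω → ℝ) {α β : Type*} [Fintype α] [Fintype β] (X : Ω → α) (Y : Ω → β) : ℝ :=
  H w (fun ω => (X ω, Y ω)) - H w Y

/-- Mutual information I(X;Y). -/
def mutInfo (w : Ω → ℝ) {α β : Type*} [Fintype α] [Fintype β] (X : Ω → α) (Y : Ω → β) : ℝ :=
  H w X + H w Y - H w (fun ω => (X ω, Y ω))

/-- Conditional mutual information I(X;Y|Z). -/
def condMutInfo (w : Ω → ℝ) {α β γ : Type*} [Fintype α] [Fintype β] [Fintype γ]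
    (X : Ω → α) (Y : Ω → β) (Z : Ω → γ) : ℝ :=
  condH w X Z - condH w X (fun ω => (Y ω, Z ω))

/-- Expectation of a real random variable. -/
def expect (w : Ω → ℝ) (f : Ω → ℝ) : ℝ := ∑ ω, w ω * f ω

end IT

/-- `p` is a probability mass function on a finite type. -/
def IsPMF {α : Type*} [Fintype α] (p : α → ℝ) : Prop := (∀ a, 0 ≤ p a) ∧ ∑ a, p a = 1

/-- The i.i.d. (product) weight on `n`-sequences induced by a single-letter pmf. -/
def iidW {α : Type*} (p : α → ℝ) (n : ℕ) : (Fin n → α) → ℝ := fun x => ∏ t, p (x t)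

/-- The first `l` components of a dependent tuple (the rest masked). -/
def trunc {K : ℕ} {γ : Fin K → Type*} (l : ℕ) (f : (k : Fin K) → γ k) :
    (k : Fin K) → Option (γ k) :=
  fun k => if k.val < l then some (f k) else none

/-- Coordinates with (0-based) index `< t`. -/
def below {n : ℕ} {α : Type*} (t : ℕ) (x : Fin n → α) : Fin n → Option α :=
  fun s => if s.val < t then some (x s) else none

/-- Coordinates with (0-based) index `> t`. -/
def above {n : ℕ} {α : Type*} (t : ℕ) (x : Fin n → α) : Fin n → Option α :=
  fun s => if t < s.val then some (x s) else none

/-- Coordinates with (0-based) index `≥ t`. -/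
def fromIdx {n : ℕ} {α : Type*} (t : ℕ) (x : Fin n → α) : Fin n → Option α :=
  fun s => if t ≤ s.val then some (x s) else none

open Classical in
/-- Number of occurrences of `a` in the sequence `x`. -/
def Nocc {n : ℕ} {α : Type*} (a : α) (x : Fin n → α) : ℕ :=
  (Finset.univ.filter fun t => x t = a).card

/-- Strongly typical set. -/
def typical {α : Type*} [Fintype α] (Q : α → ℝ) (δ : ℝ) (n : ℕ) : Set (Fin n → α) :=
  {x | ∀ a, Q a ≠ 0 → |(Nocc a x : ℝ) / n - Q a| ≤ δ / Fintype.card α}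


open IT


section OneShot

open Classical in
/-- Real-valued indicator of a proposition. -/
def ind (P : Prop) : ℝ := if P then 1 else 0

lemma ind_true {P : Prop} (h : P) : ind P = 1 := by simp [ind, h]

lemma ind_false {P : Prop} (h : ¬ P) : ind P = 0 := by simp [ind, h]

lemma ind_nonneg (P : Prop) : 0 ≤ ind P := by
  by_cases h : P <;> simp [ind, h]

lemma ind_le_one (P : Prop) : ind P ≤ 1 := by
  by_cases h : P <;> simp [ind, h]

/-- Uniform average over a finite type. -/
def avg {Ω : Type*} [Fintype Ω] (F : Ω → ℝ) : ℝ := (∑ x, F x) / Fintype.card Ω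

lemma avg_add {Ω : Type*} [Fintype Ω] (F G : Ω → ℝ) :
    avg (fun x => F x + G x) = avg F + avg G := by
  simp [avg, Finset.sum_add_distrib, add_div]

lemma avg_sub {Ω : Type*} [Fintype Ω] (F G : Ω → ℝ) :
    avg (fun x => F x - G x) = avg F - avg G := by
  simp [avg, Finset.sum_sub_distrib, sub_div]

lemma avg_const_mul {Ω : Type*} [Fintype Ω] (c : ℝ) (F : Ω → ℝ) :
    avg (fun x => c * F x) = c * avg F := by
  simp [avg, ← Finset.mul_sum, mul_div_assoc]

lemma avg_sum {Ω ι : Type*} [Fintype Ω] [Fintype ι] (F : ι → Ω → ℝ) :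
    avg (fun x => ∑ i, F i x) = ∑ i, avg (F i) := by
  simp only [avg]
  rw [Finset.sum_comm, Finset.sum_div]

lemma avg_mono {Ω : Type*} [Fintype Ω] {F G : Ω → ℝ} (h : ∀ x, F x ≤ G x) :
    avg F ≤ avg G := by
  unfold avg
  gcongr with x
  exact h x

lemma avg_prod {X Y : Type*} [Fintype X] [Fintype Y] (f : X → ℝ) (g : Y → ℝ) :
    avg (fun z : X × Y => f z.1 * g z.2) = avg f * avg g := by
  simp only [avg, Fintype.sum_prod_type, Fintype.card_prod, Nat.cast_mul]
  rw [← Finset.sum_mul_sum]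
  rw [div_mul_div_comm]

lemma exists_ge_avg {Ω : Type*} [Fintype Ω] [Nonempty Ω] (F : Ω → ℝ) :
    ∃ x, avg F ≤ F x := by
  by_contra! h
  have h1 : ∑ x, F x < ∑ _x : Ω, avg F :=
    Finset.sum_lt_sum_of_nonempty Finset.univ_nonempty (fun x _ => h x)
  have hc : (0 : ℝ) < Fintype.card Ω := by exact_mod_cast Fintype.card_pos
  have h2 : ∑ _x : Ω, avg F = ∑ x, F x := by
    simp only [Finset.sum_const, Finset.card_univ, nsmul_eq_mul, avg]
    field_simp
  linarith

lemma sum_resample {I M : Type*} [Fintype I] [DecidableEq I] [Fintype M]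
    (F : (I → M) → ℝ) (a : I) :
    ∑ β, ∑ i, F (Function.update β a i) = Fintype.card M * ∑ β, F β := by
  have h : ∑ z : (I → M) × M, F (Function.update z.1 a z.2) = ∑ z : (I → M) × M, F z.1 := by
    refine Finset.sum_bij' (fun z _ => (Function.update z.1 a z.2, z.1 a))
      (fun z _ => (Function.update z.1 a z.2, z.1 a)) ?_ ?_ ?_ ?_ ?_ <;> simp
  rw [Fintype.sum_prod_type, Fintype.sum_prod_type] at h
  rw [h]
  simp [Finset.mul_sum]

lemma avg_one_coord {I M : Type*} [Fintype I] [DecidableEq I] [Fintype M] [Nonempty M]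
    (f : M → ℝ) (a : I) :
    avg (fun β : I → M => f (β a)) = avg f := by
  have h := sum_resample (fun β : I → M => f (β a)) a
  simp only [Function.update_self, Finset.sum_const, Finset.card_univ, nsmul_eq_mul] at h
  have hc : (0 : ℝ) < Fintype.card M := by exact_mod_cast Fintype.card_pos
  have hc' : (0 : ℝ) < Fintype.card (I → M) := by exact_mod_cast Fintype.card_pos
  unfold avg
  rw [div_eq_div_iff hc'.ne' hc.ne']
  linarith

lemma avg_two_coord {I M : Type*} [Fintype I] [DecidableEq I] [Fintype M] [Nonempty M]
    (f : M → M → ℝ) (a b : I) (hab : a ≠ b) :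
    avg (fun β : I → M => f (β a) (β b)) = avg (fun i => avg (fun j => f i j)) := by
  have h := sum_resample (fun β : I → M => f (β a) (β b)) b
  simp only [Function.update_self, Function.update_of_ne hab] at h
  have hc : (0 : ℝ) < Fintype.card M := by exact_mod_cast Fintype.card_pos
  have h2 := avg_one_coord (I := I) (fun i => avg (fun j => f i j)) a
  rw [← h2]
  unfold avg
  congr 1
  rw [← Finset.sum_div, h]
  field_simp

variable {I : Type*} [Fintype I] [DecidableEq I]

lemma sum_ind_eq {M : Type*} [Fintype M] (c : M) : ∑ x, ind (x = c) = 1 := by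
  classical
  simp [ind]

lemma avg_ind_snd (m k : ℕ) (hm : 0 < m) :
    avg (fun i : Fin m × Fin (k + 1) => ind (i.2 = 0)) = 1 / (k + 1) := by
  have hm' : (0 : ℝ) < m := by exact_mod_cast hm
  simp only [avg, Fintype.sum_prod_type, sum_ind_eq]
  simp
  field_simp

lemma avg_ind_eq (m k : ℕ) (c : Fin m × Fin (k + 1)) :
    avg (fun i : Fin m × Fin (k + 1) => ind (i = c)) = 1 / (m * (k + 1)) := by
  simp only [avg, sum_ind_eq]
  simp

lemma avg_mul_const {Ω : Type*} [Fintype Ω] (c : ℝ) (F : Ω → ℝ) :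
    avg (fun x => F x * c) = avg F * c := by
  simp_rw [mul_comm _ c]
  exact avg_const_mul c F

lemma avg_sel (m k : ℕ) (hm : 0 < m) (a : I) :
    avg (fun β : I → Fin m × Fin (k + 1) => ind ((β a).2 = 0)) = 1 / (k + 1) := by
  have : Nonempty (Fin m) := ⟨⟨0, hm⟩⟩
  rw [avg_one_coord (fun i : Fin m × Fin (k + 1) => ind (i.2 = 0)) a]
  exact avg_ind_snd m k hm

lemma avg_sel_sel (m k : ℕ) (hm : 0 < m) (a b : I) (hab : a ≠ b) :
    avg (fun β : I → Fin m × Fin (k + 1) => ind ((β a).2 = 0) * ind ((β b).2 = 0))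
      = 1 / (k + 1) * (1 / (k + 1)) := by
  have : Nonempty (Fin m) := ⟨⟨0, hm⟩⟩
  rw [avg_two_coord (fun i j : Fin m × Fin (k + 1) => ind (i.2 = 0) * ind (j.2 = 0)) a b hab]
  simp_rw [avg_const_mul, avg_ind_snd m k hm, avg_mul_const, avg_ind_snd m k hm]

lemma avg_sel_coll (m k : ℕ) (hm : 0 < m) (a b : I) (hab : a ≠ b) :
    avg (fun β : I → Fin m × Fin (k + 1) => ind ((β a).2 = 0) * ind (β b = ((β a).1, 0)))
      = 1 / (k + 1) * (1 / (m * (k + 1))) := by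
  have : Nonempty (Fin m) := ⟨⟨0, hm⟩⟩
  rw [avg_two_coord (fun i j : Fin m × Fin (k + 1) => ind (i.2 = 0) * ind (j = (i.1, 0))) a b hab]
  simp_rw [avg_const_mul, avg_ind_eq, avg_mul_const, avg_ind_snd m k hm]

/-- The weighted mass of the selected set, multiplied by the selection indicator. -/
lemma avg_mass (m k : ℕ) (hm : 0 < m) (P : I → ℝ) (a : I) :
    avg (fun β : I → Fin m × Fin (k + 1) =>
      ind ((β a).2 = 0) * ((k + 1) * ∑ a', P a' * ind ((β a').2 = 0)))
      = 1 / (k + 1) * ((∑ a', P a') + k * P a) := by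
  have h1 : ∀ β : I → Fin m × Fin (k + 1),
      ind ((β a).2 = 0) * ((k + 1) * ∑ a', P a' * ind ((β a').2 = 0))
      = ∑ a', ((k + 1) * P a') * (ind ((β a).2 = 0) * ind ((β a').2 = 0)) := by
    intro β
    rw [Finset.mul_sum, Finset.mul_sum]
    refine Finset.sum_congr rfl fun a' _ => by ring
  simp_rw [h1]
  rw [avg_sum]
  simp_rw [avg_const_mul]
  have h2 : ∀ a', avg (fun β : I → Fin m × Fin (k + 1) =>
      ind ((β a).2 = 0) * ind ((β a').2 = 0))
      = 1 / (k + 1) * (1 / (k + 1) + (if a' = a then (k : ℝ) / (k + 1) else 0)) := by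
    intro a'
    split_ifs with h
    · subst h
      have : ∀ β : I → Fin m × Fin (k + 1), ind ((β a').2 = 0) * ind ((β a').2 = 0)
          = ind ((β a').2 = 0) := by
        intro β
        by_cases h : (β a').2 = 0 <;> simp [ind, h]
      simp_rw [this]
      rw [avg_sel m k hm]
      field_simp
      ring
    · rw [avg_sel_sel m k hm a a' (Ne.symm h)]
      ring
  simp_rw [h2, mul_add, Finset.sum_add_distrib]
  simp only [mul_ite, mul_zero, Finset.sum_ite_eq', Finset.mem_univ, if_true]
  rw [Finset.mul_sum]
  congr 1
  · refine Finset.sum_congr rfl fun a' _ => by field_simp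
  · field_simp

end OneShot

section OneShot2

/-- Selection indicator of a codeword. -/
def sel {I : Type*} {m k : ℕ} (β : I → Fin m × Fin (k + 1)) (a : I) : ℝ := ind ((β a).2 = 0)

/-- Collision indicator. -/
def coll {I : Type*} {m k : ℕ} (β : I → Fin m × Fin (k + 1)) (a b : I) : ℝ :=
  ind (β b = ((β a).1, 0))

lemma sel_nonneg {I : Type*} {m k : ℕ} (β : I → Fin m × Fin (k + 1)) (a : I) : 0 ≤ sel β a :=
  ind_nonneg _

lemma coll_nonneg {I : Type*} {m k : ℕ} (β : I → Fin m × Fin (k + 1)) (a b : I) :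
    0 ≤ coll β a b := ind_nonneg _

/-- Number of wrong candidates. -/
def wrong {A B : Type*} [Fintype A] [Fintype B] {m1 k1 m2 k2 : ℕ}
    (T12 : A → Prop) (T3 : A → B → Prop) (a : A) (b : B)
    (β : (A → Fin m1 × Fin (k1 + 1)) × (A × B → Fin m2 × Fin (k2 + 1))) : ℝ :=
  (∑ a', ind (a' ≠ a ∧ T12 a') * coll β.1 a a')
  + (∑ b', ind (b' ≠ b ∧ T3 a b') * coll β.2 (a, b) (a, b'))
  + ∑ a', ∑ b', ind (a' ≠ a ∧ T3 a' b') * (coll β.1 a a' * coll β.2 (a, b) (a', b'))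

lemma wrong_nonneg {A B : Type*} [Fintype A] [Fintype B] {m1 k1 m2 k2 : ℕ}
    (T12 : A → Prop) (T3 : A → B → Prop) (a : A) (b : B)
    (β : (A → Fin m1 × Fin (k1 + 1)) × (A × B → Fin m2 × Fin (k2 + 1))) :
    0 ≤ wrong T12 T3 a b β := by
  unfold wrong
  have := @ind_nonneg
  refine add_nonneg (add_nonneg (Finset.sum_nonneg fun _ _ => mul_nonneg (this _) (coll_nonneg _ _ _))
    (Finset.sum_nonneg fun _ _ => mul_nonneg (this _) (coll_nonneg _ _ _)))
    (Finset.sum_nonneg fun _ _ => Finset.sum_nonneg fun _ _ => mul_nonneg (this _)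
      (mul_nonneg (coll_nonneg _ _ _) (coll_nonneg _ _ _)))

lemma amgm3 {x y : ℝ} (hx : 0 < x) (hy : 0 < y) : 3 - x - y ≤ 1 / (x * y) := by
  rw [le_div_iff₀ (by positivity)]
  by_cases h : 3 - x - y ≤ 0
  · have : 0 < x * y := by positivity
    nlinarith
  · push Not at h
    -- AM-GM for x, y, z = 3 - x - y
    nlinarith [mul_nonneg hx.le (sq_nonneg (y - (3 - x - y))),
      mul_nonneg hy.le (sq_nonneg (x - (3 - x - y))), mul_nonneg h.le (sq_nonneg (x - y)),
      sq_nonneg (x - y), sq_nonneg (y - (3 - x - y)), sq_nonneg (x - (3 - x - y))]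

lemma avg_wrong_le {A B : Type*} [Fintype A] [Fintype B] [DecidableEq A] [DecidableEq B]
    {m1 k1 m2 k2 : ℕ} (hm1 : 0 < m1) (hm2 : 0 < m2)
    (T12 : A → Prop) (T3 : A → B → Prop) (a : A) (b : B) :
    avg (fun β : (A → Fin m1 × Fin (k1 + 1)) × (A × B → Fin m2 × Fin (k2 + 1)) =>
      (sel β.1 a * sel β.2 (a, b)) * wrong T12 T3 a b β) ≤
    1 / (k1 + 1) * (1 / (k2 + 1)) * ((∑ a', ind (T12 a')) * (1 / (m1 * (k1 + 1)))
      + (∑ b', ind (T3 a b')) * (1 / (m2 * (k2 + 1)))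
      + (∑ a', ∑ b', ind (T3 a' b')) * (1 / (m1 * (k1 + 1)) * (1 / (m2 * (k2 + 1))))) := by
  have hexp : ∀ β : (A → Fin m1 × Fin (k1 + 1)) × (A × B → Fin m2 × Fin (k2 + 1)),
      (sel β.1 a * sel β.2 (a, b)) * wrong T12 T3 a b β =
      (∑ a', ind (a' ≠ a ∧ T12 a') * ((sel β.1 a * coll β.1 a a') * sel β.2 (a, b)))
      + (∑ b', ind (b' ≠ b ∧ T3 a b') *
          (sel β.1 a * (sel β.2 (a, b) * coll β.2 (a, b) (a, b'))))
      + ∑ a', ∑ b', ind (a' ≠ a ∧ T3 a' b') *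
          ((sel β.1 a * coll β.1 a a') * (sel β.2 (a, b) * coll β.2 (a, b) (a', b'))) := by
    intro β
    unfold wrong
    rw [mul_add, mul_add, Finset.mul_sum, Finset.mul_sum, Finset.mul_sum]
    congr 1
    · congr 1
      · exact Finset.sum_congr rfl fun _ _ => by ring
      · exact Finset.sum_congr rfl fun _ _ => by ring
    · refine Finset.sum_congr rfl fun _ _ => ?_
      rw [Finset.mul_sum]
      exact Finset.sum_congr rfl fun _ _ => by ring
  simp_rw [hexp]
  rw [avg_add, avg_add, avg_sum, avg_sum, avg_sum]
  simp_rw [avg_sum, avg_const_mul]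
  have e1 : ∀ a', a' ≠ a → avg (fun β : (A → Fin m1 × Fin (k1 + 1)) ×
      (A × B → Fin m2 × Fin (k2 + 1)) => (sel β.1 a * coll β.1 a a') * sel β.2 (a, b))
      = (1 / (k1 + 1) * (1 / (m1 * (k1 + 1)))) * (1 / (k2 + 1)) := by
    intro a' h
    rw [avg_prod (fun β : A → Fin m1 × Fin (k1 + 1) => sel β a * coll β a a')
      (fun β : A × B → Fin m2 × Fin (k2 + 1) => sel β (a, b))]
    congr 1
    · exact avg_sel_coll m1 k1 hm1 a a' h.symm
    · exact avg_sel m2 k2 hm2 _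
  have e2 : ∀ b', b' ≠ b → avg (fun β : (A → Fin m1 × Fin (k1 + 1)) ×
      (A × B → Fin m2 × Fin (k2 + 1)) => sel β.1 a * (sel β.2 (a, b) * coll β.2 (a, b) (a, b')))
      = 1 / (k1 + 1) * (1 / (k2 + 1) * (1 / (m2 * (k2 + 1)))) := by
    intro b' h
    rw [avg_prod (fun β : A → Fin m1 × Fin (k1 + 1) => sel β a)
      (fun β : A × B → Fin m2 × Fin (k2 + 1) => sel β (a, b) * coll β (a, b) (a, b'))]
    congr 1
    · exact avg_sel m1 k1 hm1 _
    · exact avg_sel_coll m2 k2 hm2 (a, b) (a, b') (by simpa using h.symm)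
  have e3 : ∀ a' b', a' ≠ a → avg (fun β : (A → Fin m1 × Fin (k1 + 1)) ×
      (A × B → Fin m2 × Fin (k2 + 1)) =>
        (sel β.1 a * coll β.1 a a') * (sel β.2 (a, b) * coll β.2 (a, b) (a', b')))
      = (1 / (k1 + 1) * (1 / (m1 * (k1 + 1)))) * (1 / (k2 + 1) * (1 / (m2 * (k2 + 1)))) := by
    intro a' b' h
    rw [avg_prod (fun β : A → Fin m1 × Fin (k1 + 1) => sel β a * coll β a a')
      (fun β : A × B → Fin m2 × Fin (k2 + 1) => sel β (a, b) * coll β (a, b) (a', b'))]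
    congr 1
    · exact avg_sel_coll m1 k1 hm1 a a' h.symm
    · exact avg_sel_coll m2 k2 hm2 (a, b) (a', b') (by
        intro hh; exact h (congrArg Prod.fst hh).symm)
  have key : ∀ (N P : Prop) (z c : ℝ), 0 ≤ c → (N → z = c) → ind (N ∧ P) * z ≤ ind P * c := by
    intro N P z c hc hz
    by_cases hN : N
    · rw [hz hN]
      by_cases hP : P
      · simp [ind, hN, hP]
      · simp [ind, hN, hP]
    · rw [ind_false (fun h => hN h.1), zero_mul]
      exact mul_nonneg (ind_nonneg _) hc
  have hb1 : ∀ a', ind (a' ≠ a ∧ T12 a') * _ ≤ _ := fun a' =>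
    key (a' ≠ a) (T12 a') _ _ (by positivity) (e1 a')
  have hb2 : ∀ b', ind (b' ≠ b ∧ T3 a b') * _ ≤ _ := fun b' =>
    key (b' ≠ b) (T3 a b') _ _ (by positivity) (e2 b')
  have hb3 : ∀ a' b', ind (a' ≠ a ∧ T3 a' b') * _ ≤ _ := fun a' b' =>
    key (a' ≠ a) (T3 a' b') _ _ (by positivity) (e3 a' b')
  refine (add_le_add (add_le_add (Finset.sum_le_sum fun a' _ => hb1 a')
    (Finset.sum_le_sum fun b' _ => hb2 b'))
    (Finset.sum_le_sum fun a' _ => Finset.sum_le_sum fun b' _ => hb3 a' b')).trans ?_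
  simp_rw [← Finset.sum_mul]
  apply le_of_eq
  ring

lemma oneshot_pt {A B : Type*} [Fintype A] [Fintype B] [DecidableEq A] [DecidableEq B]
    {m1 k1 m2 k2 : ℕ} (hm1 : 0 < m1) (hm2 : 0 < m2)
    (P1 : A → ℝ) (hP1 : ∀ a, 0 ≤ P1 a) (hP1s : ∑ a, P1 a = 1)
    (P2 : B → ℝ) (hP2 : ∀ b, 0 ≤ P2 b) (hP2s : ∑ b, P2 b = 1)
    (T12 : A → Prop) (T3 : A → B → Prop) (a : A) (b : B) :
    P1 a * P2 b * (1 - k1 * P1 a - k2 * P2 b - 3 * ((∑ a', ind (T12 a')) * (1 / (m1 * (k1 + 1)))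
      + (∑ b', ind (T3 a b')) * (1 / (m2 * (k2 + 1)))
      + (∑ a', ∑ b', ind (T3 a' b')) * (1 / (m1 * (k1 + 1)) * (1 / (m2 * (k2 + 1))))))
    ≤ avg (fun β : (A → Fin m1 × Fin (k1 + 1)) × (A × B → Fin m2 × Fin (k2 + 1)) =>
      (sel β.1 a * P1 a / ∑ a', P1 a' * sel β.1 a') *
      (sel β.2 (a, b) * P2 b / ∑ b', P2 b' * sel β.2 (a, b')) *
      ind (wrong T12 T3 a b β < 1)) := by
  have hpt : ∀ β : (A → Fin m1 × Fin (k1 + 1)) × (A × B → Fin m2 × Fin (k2 + 1)),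
      P1 a * P2 b * (k1 + 1) * (k2 + 1) *
       (3 * (sel β.1 a * sel β.2 (a, b))
        - (sel β.1 a * ((k1 + 1) * ∑ a', P1 a' * sel β.1 a')) * sel β.2 (a, b)
        - sel β.1 a * (sel β.2 (a, b) * ((k2 + 1) * ∑ b', P2 b' * sel β.2 (a, b')))
        - 3 * ((sel β.1 a * sel β.2 (a, b)) * wrong T12 T3 a b β))
      ≤ (sel β.1 a * P1 a / ∑ a', P1 a' * sel β.1 a') *
      (sel β.2 (a, b) * P2 b / ∑ b', P2 b' * sel β.2 (a, b')) *
      ind (wrong T12 T3 a b β < 1) := by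
    intro β
    have hS1 : P1 a * sel β.1 a ≤ ∑ a', P1 a' * sel β.1 a' :=
      Finset.single_le_sum (f := fun a' => P1 a' * sel β.1 a')
        (fun i _ => mul_nonneg (hP1 i) (sel_nonneg _ _)) (Finset.mem_univ a)
    have hS2 : P2 b * sel β.2 (a, b) ≤ ∑ b', P2 b' * sel β.2 (a, b') :=
      Finset.single_le_sum (f := fun b' => P2 b' * sel β.2 (a, b'))
        (fun i _ => mul_nonneg (hP2 i) (sel_nonneg _ _)) (Finset.mem_univ b)
    have hW := wrong_nonneg T12 T3 a b β
    generalize (∑ a', P1 a' * sel β.1 a') = s1 at *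
    generalize (∑ b', P2 b' * sel β.2 (a, b')) = s2 at *
    generalize wrong T12 T3 a b β = W at *
    by_cases h1 : (β.1 a).2 = 0
    swap
    · have : sel β.1 a = 0 := ind_false h1
      simp [this]
    by_cases h2 : (β.2 (a, b)).2 = 0
    swap
    · have : sel β.2 (a, b) = 0 := ind_false h2
      simp [this]
    have h1' : sel β.1 a = 1 := ind_true h1
    have h2' : sel β.2 (a, b) = 1 := ind_true h2
    rw [h1'] at hS1
    rw [h2'] at hS2
    rw [h1', h2']
    rcases (hP1 a).eq_or_lt with h0 | hpos1
    · simp [← h0]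
    rcases (hP2 b).eq_or_lt with h0 | hpos2
    · simp [← h0]
    have hs1 : 0 < s1 := by linarith
    have hs2 : 0 < s2 := by linarith
    have hx : 0 < (k1 + 1) * s1 := by positivity
    have hy : 0 < (k2 + 1) * s2 := by positivity
    have hag := amgm3 hx hy
    have hcore : 3 - (k1 + 1) * s1 - (k2 + 1) * s2 - 3 * W
        ≤ 1 / ((k1 + 1) * s1 * ((k2 + 1) * s2)) * ind (W < 1) := by
      by_cases hw : W < 1
      · rw [ind_true hw]
        linarith
      · rw [ind_false hw]
        push Not at hw
        linarith
    have hmul := mul_le_mul_of_nonneg_left hcore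
      (show 0 ≤ P1 a * P2 b * (k1 + 1) * (k2 + 1) by positivity)
    refine le_trans (le_of_eq ?_) (hmul.trans (le_of_eq ?_))
    · ring
    · field_simp
  refine le_trans ?_ (avg_mono hpt)
  rw [avg_const_mul, avg_sub, avg_sub, avg_sub, avg_const_mul, avg_const_mul]
  have e0 : avg (fun β : (A → Fin m1 × Fin (k1 + 1)) × (A × B → Fin m2 × Fin (k2 + 1)) =>
      sel β.1 a * sel β.2 (a, b)) = 1 / (k1 + 1) * (1 / (k2 + 1)) := by
    rw [avg_prod (fun β : A → Fin m1 × Fin (k1 + 1) => sel β a)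
      (fun β : A × B → Fin m2 × Fin (k2 + 1) => sel β (a, b))]
    congr 1
    · exact avg_sel m1 k1 hm1 _
    · exact avg_sel m2 k2 hm2 _
  have e1 : avg (fun β : (A → Fin m1 × Fin (k1 + 1)) × (A × B → Fin m2 × Fin (k2 + 1)) =>
      (sel β.1 a * ((k1 + 1) * ∑ a', P1 a' * sel β.1 a')) * sel β.2 (a, b))
      = 1 / (k1 + 1) * (1 + k1 * P1 a) * (1 / (k2 + 1)) := by
    rw [avg_prod (fun β : A → Fin m1 × Fin (k1 + 1) =>
        sel β a * ((k1 + 1) * ∑ a', P1 a' * sel β a'))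
      (fun β : A × B → Fin m2 × Fin (k2 + 1) => sel β (a, b))]
    congr 1
    · have := avg_mass m1 k1 hm1 P1 a
      rw [hP1s] at this
      exact this
    · exact avg_sel m2 k2 hm2 _
  have e2 : avg (fun β : (A → Fin m1 × Fin (k1 + 1)) × (A × B → Fin m2 × Fin (k2 + 1)) =>
      sel β.1 a * (sel β.2 (a, b) * ((k2 + 1) * ∑ b', P2 b' * sel β.2 (a, b'))))
      = 1 / (k1 + 1) * (1 / (k2 + 1) * (1 + k2 * P2 b)) := by
    rw [avg_prod (fun β : A → Fin m1 × Fin (k1 + 1) => sel β a)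
      (fun β : A × B → Fin m2 × Fin (k2 + 1) =>
        sel β (a, b) * ((k2 + 1) * ∑ b', P2 b' * sel β (a, b')))]
    congr 1
    · exact avg_sel m1 k1 hm1 _
    · have := avg_mass m2 k2 hm2 (fun z : A × B => if z.1 = a then P2 z.2 else 0) (a, b)
      simp only [Fintype.sum_prod_type, if_true] at this
      rw [Finset.sum_comm] at this
      simp only [Finset.sum_ite_eq', Finset.mem_univ, if_true, hP2s] at this
      rw [← this]
      congr 1
      funext β
      unfold sel
      congr 2
      rw [Finset.sum_comm]
      refine Finset.sum_congr rfl fun b' _ => ?_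
      simp [ite_mul]
  have e3 := avg_wrong_le (k1 := k1) (k2 := k2) hm1 hm2 T12 T3 a b
  rw [e0, e1, e2]
  have hnn : 0 ≤ P1 a * P2 b * (k1 + 1) * (k2 + 1) := by
    have := hP1 a
    have := hP2 b
    positivity
  refine le_trans (le_of_eq ?_) (mul_le_mul_of_nonneg_left
    (sub_le_sub_left (mul_le_mul_of_nonneg_left e3 (by norm_num : (0 : ℝ) ≤ 3)) _) hnn)
  field_simp
  ring

/-- Derandomization of a stochastic (sub-)kernel. -/
lemma derand {Ω α A : Type*} [Fintype Ω] [Fintype α] [Fintype A] [Nonempty A]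
    (y : Ω → α) (K : α → A → ℝ) (hK : ∀ i a, 0 ≤ K i a) (hKs : ∀ i, ∑ a, K i a ≤ 1)
    (G : Ω → A → ℝ) (hG : ∀ ω a, 0 ≤ G ω a) :
    ∃ φ : α → A, ∑ ω, ∑ a, K (y ω) a * G ω a ≤ ∑ ω, G ω (φ (y ω)) := by
  classical
  have hmax : ∀ i : α, ∃ a : A, ∀ a', ∑ ω, (if y ω = i then G ω a' else 0)
      ≤ ∑ ω, (if y ω = i then G ω a else 0) := by
    intro i
    obtain ⟨a, -, ha⟩ := Finset.exists_max_image (Finset.univ : Finset A)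
      (fun a => ∑ ω, (if y ω = i then G ω a else 0)) Finset.univ_nonempty
    exact ⟨a, fun a' => ha a' (Finset.mem_univ _)⟩
  choose φ hφ using hmax
  refine ⟨φ, ?_⟩
  have h1 : ∑ ω, ∑ a, K (y ω) a * G ω a
      = ∑ i, ∑ a, K i a * ∑ ω, (if y ω = i then G ω a else 0) := by
    simp_rw [Finset.mul_sum]
    symm
    calc ∑ i, ∑ a, ∑ ω, K i a * (if y ω = i then G ω a else 0)
        = ∑ i, ∑ ω, ∑ a, K i a * (if y ω = i then G ω a else 0) :=
          Finset.sum_congr rfl fun i _ => Finset.sum_comm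
      _ = ∑ ω, ∑ i, ∑ a, K i a * (if y ω = i then G ω a else 0) := Finset.sum_comm
      _ = ∑ ω, ∑ a, ∑ i, K i a * (if y ω = i then G ω a else 0) :=
          Finset.sum_congr rfl fun i _ => Finset.sum_comm
      _ = _ := by simp
  have h2 : ∑ ω, G ω (φ (y ω)) = ∑ i, ∑ ω, (if y ω = i then G ω (φ i) else 0) := by
    rw [Finset.sum_comm]
    refine Finset.sum_congr rfl fun ω _ => ?_
    simp
  rw [h1, h2]
  refine Finset.sum_le_sum fun i _ => ?_
  calc ∑ a, K i a * ∑ ω, (if y ω = i then G ω a else 0)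
      ≤ ∑ a, K i a * ∑ ω, (if y ω = i then G ω (φ i) else 0) :=
        Finset.sum_le_sum fun a _ => mul_le_mul_of_nonneg_left (hφ i a) (hK i a)
    _ = (∑ a, K i a) * ∑ ω, (if y ω = i then G ω (φ i) else 0) := by rw [Finset.sum_mul]
    _ ≤ 1 * ∑ ω, (if y ω = i then G ω (φ i) else 0) := by
        refine mul_le_mul_of_nonneg_right (hKs i) (Finset.sum_nonneg fun ω _ => ?_)
        split_ifs
        · exact hG _ _
        · exact le_rfl
    _ = _ := one_mul _

end OneShot2

section OneShot3

lemma subkernel_sum_le {A : Type*} [Fintype A] (f : A → ℝ) :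
    ∑ a, f a / ∑ a', f a' ≤ 1 := by
  rw [← Finset.sum_div]
  exact div_self_le_one _

lemma wrong_lt_one {A B : Type*} [Fintype A] [Fintype B] {m1 k1 m2 k2 : ℕ}
    (T12 : A → Prop) (T3 : A → B → Prop) (a : A) (b : B)
    (β : (A → Fin m1 × Fin (k1 + 1)) × (A × B → Fin m2 × Fin (k2 + 1)))
    (h : wrong T12 T3 a b β < 1) :
    (∀ a', T12 a' → β.1 a' = ((β.1 a).1, 0) → a' = a) ∧
    (∀ a' b', T3 a' b' → β.1 a' = ((β.1 a).1, 0) → β.2 (a', b') = ((β.2 (a, b)).1, 0) →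
      a' = a ∧ b' = b) := by
  have t1 : ∀ a', 0 ≤ ind (a' ≠ a ∧ T12 a') * coll β.1 a a' :=
    fun _ => mul_nonneg (ind_nonneg _) (coll_nonneg _ _ _)
  have t2 : ∀ b', 0 ≤ ind (b' ≠ b ∧ T3 a b') * coll β.2 (a, b) (a, b') :=
    fun _ => mul_nonneg (ind_nonneg _) (coll_nonneg _ _ _)
  have t3 : ∀ a' b', 0 ≤ ind (a' ≠ a ∧ T3 a' b') *
      (coll β.1 a a' * coll β.2 (a, b) (a', b')) :=
    fun _ _ => mul_nonneg (ind_nonneg _) (mul_nonneg (coll_nonneg _ _ _) (coll_nonneg _ _ _))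
  have s1 := Finset.sum_nonneg (s := Finset.univ) fun a' _ => t1 a'
  have s2 := Finset.sum_nonneg (s := Finset.univ) fun b' _ => t2 b'
  have s3 := Finset.sum_nonneg (s := Finset.univ) fun a' _ =>
    Finset.sum_nonneg (s := Finset.univ) fun b' _ => t3 a' b'
  unfold wrong at h
  constructor
  · intro a' hT hβ
    by_contra hne
    have := Finset.single_le_sum (f := fun a' => ind (a' ≠ a ∧ T12 a') * coll β.1 a a')
      (fun i _ => t1 i) (Finset.mem_univ a')
    simp only [coll] at this
    rw [ind_true ⟨hne, hT⟩, ind_true hβ] at this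
    simp only [coll] at *
    linarith
  · intro a' b' hT hβ1 hβ2
    have ha : a' = a := by
      by_contra hne
      have u1 := Finset.single_le_sum (f := fun a' => ∑ b', ind (a' ≠ a ∧ T3 a' b') *
        (coll β.1 a a' * coll β.2 (a, b) (a', b')))
        (fun i _ => Finset.sum_nonneg fun j _ => t3 i j) (Finset.mem_univ a')
      have u2 := Finset.single_le_sum (f := fun b' => ind (a' ≠ a ∧ T3 a' b') *
        (coll β.1 a a' * coll β.2 (a, b) (a', b')))
        (fun j _ => t3 a' j) (Finset.mem_univ b')
      have u3 : ind (a' ≠ a ∧ T3 a' b') * (coll β.1 a a' * coll β.2 (a, b) (a', b')) = 1 := by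
        unfold coll
        rw [ind_true ⟨hne, hT⟩, ind_true hβ1, ind_true hβ2]
        norm_num
      simp only [u3] at u2
      linarith
    subst ha
    refine ⟨rfl, ?_⟩
    by_contra hne
    have := Finset.single_le_sum (f := fun b' => ind (b' ≠ b ∧ T3 a' b') *
      coll β.2 (a', b) (a', b')) (fun i _ => t2 i) (Finset.mem_univ b')
    simp only [coll] at this
    rw [ind_true ⟨hne, hT⟩, ind_true hβ2] at this
    simp only [coll] at *
    linarith

theorem oneshot {Ω α1 α2 α3 A B : Type*} [Fintype Ω] [Fintype α1] [Fintype α2]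
    [Fintype A] [Fintype B] [Nonempty A] [Nonempty B]
    (w : Ω → ℝ) (hw : ∀ ω, 0 ≤ w ω) (y1 : Ω → α1) (y2 : Ω → α2) (y3 : Ω → α3)
    (m1 k1 m2 k2 : ℕ) (hm1 : 0 < m1) (hm2 : 0 < m2)
    (P1 : α1 → A → ℝ) (hP1 : ∀ y a, 0 ≤ P1 y a) (hP1s : ∀ y, ∑ a, P1 y a = 1)
    (P2 : α2 → A → B → ℝ) (hP2 : ∀ y a b, 0 ≤ P2 y a b) (hP2s : ∀ y a, ∑ b, P2 y a b = 1)
    (T12 : α2 → A → Prop) (T3 : α3 → A → B → Prop) (Good : Ω → A → B → Prop)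
    (hG : ∀ ω a b, Good ω a b → T12 (y2 ω) a ∧ T3 (y3 ω) a b)
    (θ : ℝ) (hG1 : ∀ ω a b, Good ω a b → k1 * P1 (y1 ω) a ≤ θ)
    (hG2 : ∀ ω a b, Good ω a b → k2 * P2 (y2 ω) a b ≤ θ)
    (hT12 : ∀ y, (∑ a, ind (T12 y a)) * (1 / (m1 * (k1 + 1))) ≤ θ)
    (hT3a : ∀ y a, (∑ b, ind (T3 y a b)) * (1 / (m2 * (k2 + 1))) ≤ θ)
    (hT3 : ∀ y, (∑ a, ∑ b, ind (T3 y a b)) * (1 / (m1 * (k1 + 1)) * (1 / (m2 * (k2 + 1)))) ≤ θ) :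
    ∃ (f1 : α1 → Fin m1) (f2 : α2 → Fin m1 → Fin m2) (g : α3 → Fin m1 → Fin m2 → A × B),
      (1 - 11 * θ) * ∑ ω, w ω * ∑ a, ∑ b, ind (Good ω a b) * (P1 (y1 ω) a * P2 (y2 ω) a b) ≤
      ∑ ω, w ω * ind (Good ω (g (y3 ω) (f1 (y1 ω)) (f2 (y2 ω) (f1 (y1 ω)))).1
        (g (y3 ω) (f1 (y1 ω)) (f2 (y2 ω) (f1 (y1 ω)))).2) := by
  classical
  have : Nonempty (Fin m1) := ⟨⟨0, hm1⟩⟩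
  have : Nonempty (Fin m2) := ⟨⟨0, hm2⟩⟩
  -- decoders
  have hd2 : ∀ (β : (A → Fin m1 × Fin (k1 + 1)) × (A × B → Fin m2 × Fin (k2 + 1)))
      (y : α2) (i : Fin m1), ∃ a : A, ∀ a0, (T12 y a0 ∧ β.1 a0 = (i, 0)) →
        (T12 y a ∧ β.1 a = (i, 0)) := by
    intro β y i
    by_cases h : ∃ a0, T12 y a0 ∧ β.1 a0 = (i, 0)
    · obtain ⟨a, ha⟩ := h
      exact ⟨a, fun _ _ => ha⟩
    · exact ⟨Classical.arbitrary A, fun a0 h0 => absurd ⟨a0, h0⟩ h⟩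
  choose d2 hd2 using hd2
  have hd3 : ∀ (β : (A → Fin m1 × Fin (k1 + 1)) × (A × B → Fin m2 × Fin (k2 + 1)))
      (y : α3) (i : Fin m1) (j : Fin m2), ∃ c : A × B, ∀ c0 : A × B,
        (T3 y c0.1 c0.2 ∧ β.1 c0.1 = (i, 0) ∧ β.2 c0 = (j, 0)) →
        (T3 y c.1 c.2 ∧ β.1 c.1 = (i, 0) ∧ β.2 c = (j, 0)) := by
    intro β y i j
    by_cases h : ∃ c0 : A × B, T3 y c0.1 c0.2 ∧ β.1 c0.1 = (i, 0) ∧ β.2 c0 = (j, 0)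
    · obtain ⟨a, ha⟩ := h
      exact ⟨a, fun _ _ => ha⟩
    · exact ⟨Classical.arbitrary _, fun a0 h0 => absurd ⟨a0, h0⟩ h⟩
  choose d3 hd3 using hd3
  -- stochastic encoders
  set K1 : ((A → Fin m1 × Fin (k1 + 1)) × (A × B → Fin m2 × Fin (k2 + 1))) → α1 → A → ℝ :=
    fun β y a => sel β.1 a * P1 y a / ∑ a', P1 y a' * sel β.1 a' with hK1
  set K2' : ((A → Fin m1 × Fin (k1 + 1)) × (A × B → Fin m2 × Fin (k2 + 1))) → α2 → A → B → ℝ :=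
    fun β y a b => sel β.2 (a, b) * P2 y a b / ∑ b', P2 y a b' * sel β.2 (a, b') with hK2'
  have hK1nn : ∀ β y a, 0 ≤ K1 β y a := fun β y a =>
    div_nonneg (mul_nonneg (sel_nonneg _ _) (hP1 _ _))
      (Finset.sum_nonneg fun _ _ => mul_nonneg (hP1 _ _) (sel_nonneg _ _))
  have hK2nn : ∀ β y a b, 0 ≤ K2' β y a b := fun β y a b =>
    div_nonneg (mul_nonneg (sel_nonneg _ _) (hP2 _ _ _))
      (Finset.sum_nonneg fun _ _ => mul_nonneg (hP2 _ _ _) (sel_nonneg _ _))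
  have hK1s : ∀ β y, ∑ a, K1 β y a ≤ 1 := by
    intro β y
    simp only [hK1]
    simp_rw [mul_comm (sel _ _)]
    exact subkernel_sum_le (fun a => P1 y a * sel β.1 a)
  have hK2s : ∀ β y a, ∑ b, K2' β y a b ≤ 1 := by
    intro β y a
    simp only [hK2']
    simp_rw [mul_comm (sel _ _)]
    exact subkernel_sum_le (fun b => P2 y a b * sel β.2 (a, b))
  -- success indicator
  set suc : ((A → Fin m1 × Fin (k1 + 1)) × (A × B → Fin m2 × Fin (k2 + 1))) → Ω → A → B → ℝ :=
    fun β ω a b =>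
      ind (Good ω (d3 β (y3 ω) (β.1 a).1 (β.2 (d2 β (y2 ω) (β.1 a).1, b)).1).1
        (d3 β (y3 ω) (β.1 a).1 (β.2 (d2 β (y2 ω) (β.1 a).1, b)).1).2) with hsuc
  set Φ : ((A → Fin m1 × Fin (k1 + 1)) × (A × B → Fin m2 × Fin (k2 + 1))) → ℝ :=
    fun β => ∑ ω, ∑ a, K1 β (y1 ω) a *
      (w ω * ∑ b, K2' β (y2 ω) (d2 β (y2 ω) (β.1 a).1) b * suc β ω a b) with hΦ
  have hterm : ∀ β ω a b, ind (Good ω a b) * (K1 β (y1 ω) a * K2' β (y2 ω) a b *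
      ind (wrong (T12 (y2 ω)) (T3 (y3 ω)) a b β < 1)) ≤
      K1 β (y1 ω) a * (K2' β (y2 ω) (d2 β (y2 ω) (β.1 a).1) b * suc β ω a b) := by
    intro β ω a b
    have hr : 0 ≤ K1 β (y1 ω) a * (K2' β (y2 ω) (d2 β (y2 ω) (β.1 a).1) b * suc β ω a b) :=
      mul_nonneg (hK1nn _ _ _) (mul_nonneg (hK2nn _ _ _ _) (ind_nonneg _))
    by_cases hg : Good ω a b
    swap
    · rw [ind_false hg, zero_mul]; exact hr
    by_cases hW : wrong (T12 (y2 ω)) (T3 (y3 ω)) a b β < 1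
    swap
    · rw [ind_false hW, mul_zero, mul_zero]; exact hr
    by_cases h1 : (β.1 a).2 = 0
    swap
    · have : K1 β (y1 ω) a = 0 := by
        simp only [hK1, sel]; rw [ind_false h1]; simp
      rw [this]; simp
    by_cases h2 : (β.2 (a, b)).2 = 0
    swap
    · have : K2' β (y2 ω) a b = 0 := by
        simp only [hK2', sel]; rw [ind_false h2]; simp
      rw [this, mul_zero, zero_mul, mul_zero]; exact hr
    obtain ⟨w1, w2⟩ := wrong_lt_one _ _ _ _ _ hW
    obtain ⟨g1, g2⟩ := hG ω a b hg
    have hb1 : β.1 a = ((β.1 a).1, 0) := Prod.ext rfl h1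
    have hb2 : β.2 (a, b) = ((β.2 (a, b)).1, 0) := Prod.ext rfl h2
    have q1 := hd2 β (y2 ω) (β.1 a).1 a ⟨g1, hb1⟩
    have e1 : d2 β (y2 ω) (β.1 a).1 = a := w1 _ q1.1 q1.2
    have q2 := hd3 β (y3 ω) (β.1 a).1 (β.2 (a, b)).1 (a, b) ⟨g2, hb1, hb2⟩
    have e2 := w2 _ _ q2.1 q2.2.1 q2.2.2
    simp only [hsuc]
    rw [e1, e2.1, e2.2, ind_true hg, ind_true hW]
    apply le_of_eq
    ring
  have hΦge : ∀ β, ∑ ω, ∑ a, ∑ b, (w ω * ind (Good ω a b)) * (K1 β (y1 ω) a * K2' β (y2 ω) a b *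
      ind (wrong (T12 (y2 ω)) (T3 (y3 ω)) a b β < 1)) ≤ Φ β := by
    intro β
    simp only [hΦ]
    refine Finset.sum_le_sum fun ω _ => Finset.sum_le_sum fun a _ => ?_
    rw [Finset.mul_sum, Finset.mul_sum]
    refine Finset.sum_le_sum fun b _ => ?_
    have := mul_le_mul_of_nonneg_left (hterm β ω a b) (hw ω)
    calc _ = w ω * (ind (Good ω a b) * (K1 β (y1 ω) a * K2' β (y2 ω) a b *
      ind (wrong (T12 (y2 ω)) (T3 (y3 ω)) a b β < 1))) := by ring
      _ ≤ _ := this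
      _ = _ := by ring
  have havg : (1 - 11 * θ) *
      ∑ ω, w ω * ∑ a, ∑ b, ind (Good ω a b) * (P1 (y1 ω) a * P2 (y2 ω) a b) ≤ avg Φ := by
    refine le_trans ?_ (avg_mono hΦge)
    simp_rw [avg_sum, avg_const_mul]
    rw [Finset.mul_sum]
    refine Finset.sum_le_sum fun ω _ => ?_
    rw [Finset.mul_sum, Finset.mul_sum]
    refine Finset.sum_le_sum fun a _ => ?_
    rw [Finset.mul_sum, Finset.mul_sum]
    refine Finset.sum_le_sum fun b _ => ?_
    by_cases hg : Good ω a b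
    swap
    · rw [ind_false hg]; simp
    rw [ind_true hg]
    have hpt := oneshot_pt (k1 := k1) (k2 := k2) hm1 hm2 (P1 (y1 ω)) (hP1 _) (hP1s _)
      (P2 (y2 ω) a) (hP2 _ _) (hP2s _ _) (T12 (y2 ω)) (T3 (y3 ω)) a b
    have hlow : P1 (y1 ω) a * P2 (y2 ω) a b * (1 - 11 * θ) ≤ _ := le_trans
      (mul_le_mul_of_nonneg_left (by
        have b1 := hG1 ω a b hg
        have b2 := hG2 ω a b hg
        have b3 := hT12 (y2 ω)
        have b4 := hT3a (y3 ω) a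
        have b5 := hT3 (y3 ω)
        linarith) (mul_nonneg (hP1 (y1 ω) a) (hP2 (y2 ω) a b))) hpt
    have := mul_le_mul_of_nonneg_left hlow (hw ω)
    refine le_trans (le_of_eq ?_) (this.trans (le_of_eq ?_))
    · ring
    · simp [hK1, hK2']
  obtain ⟨β, hβ⟩ := exists_ge_avg Φ
  have hfin := havg.trans hβ
  -- derandomize
  obtain ⟨φ1, hφ1⟩ := derand y1 (K1 β) (hK1nn β) (hK1s β)
    (fun ω a => w ω * ∑ b, K2' β (y2 ω) (d2 β (y2 ω) (β.1 a).1) b * suc β ω a b)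
    (fun ω a => mul_nonneg (hw ω) (Finset.sum_nonneg fun b _ =>
      mul_nonneg (hK2nn _ _ _ _) (ind_nonneg _)))
  obtain ⟨φ2, hφ2⟩ := derand (fun ω => (y2 ω, (β.1 (φ1 (y1 ω))).1))
    (fun z b => K2' β z.1 (d2 β z.1 z.2) b) (fun z b => hK2nn _ _ _ _) (fun z => hK2s _ _ _)
    (fun ω b => w ω * suc β ω (φ1 (y1 ω)) b)
    (fun ω b => mul_nonneg (hw ω) (ind_nonneg _))
  refine ⟨fun y => (β.1 (φ1 y)).1, fun y i => (β.2 (d2 β y i, φ2 (y, i))).1,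
    fun y i j => d3 β y i j, ?_⟩
  refine hfin.trans (hφ1.trans ?_)
  refine le_trans (le_of_eq ?_) hφ2
  refine Finset.sum_congr rfl fun ω _ => ?_
  rw [Finset.mul_sum]
  refine Finset.sum_congr rfl fun b _ => by ring

end OneShot3

section Conc

lemma sum_prod_pi {n : ℕ} {C : Type*} [Fintype C] (F : Fin n → C → ℝ) :
    ∑ c : Fin n → C, ∏ t, F t (c t) = ∏ t, ∑ x, F t x := by
  classical
  rw [Finset.prod_univ_sum]
  simp

lemma chernoff {n : ℕ} {C : Type*} [Fintype C] (κ ψ : Fin n → C → ℝ)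
    (hκ : ∀ t x, 0 ≤ κ t x) (hκs : ∀ t, ∑ x, κ t x = 1)
    (hψ : ∀ t, ∑ x, κ t x * ψ t x = 0) (M : ℝ) (hM : 1 ≤ M) (hψM : ∀ t x, |ψ t x| ≤ M)
    (τ : ℝ) (hτ : 0 < τ) (hτ1 : τ ≤ 1) :
    ∑ c : Fin n → C, (∏ t, κ t (c t)) * ind (n * τ < ∑ t, ψ t (c t))
      ≤ Real.exp (-(n * (τ ^ 2 / (4 * M ^ 2)))) := by
  set l : ℝ := τ / (2 * M ^ 2) with hl
  have hM0 : 0 < M := by linarith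
  have hl0 : 0 < l := by positivity
  have hM2 : M ≤ M ^ 2 := by nlinarith
  have hlM : l * M ≤ 1 := by
    rw [hl, div_mul_eq_mul_div, div_le_one (by positivity)]
    nlinarith
  have hpt : ∀ c : Fin n → C, (∏ t, κ t (c t)) * ind (n * τ < ∑ t, ψ t (c t))
      ≤ Real.exp (-(l * (n * τ))) * ∏ t, (κ t (c t) * Real.exp (l * ψ t (c t))) := by
    intro c
    rw [Finset.prod_mul_distrib, ← Real.exp_sum, ← Finset.mul_sum]
    have hp : 0 ≤ ∏ t, κ t (c t) := Finset.prod_nonneg fun t _ => hκ _ _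
    calc (∏ t, κ t (c t)) * ind (n * τ < ∑ t, ψ t (c t))
        ≤ (∏ t, κ t (c t)) * Real.exp (-(l * (n * τ)) + l * ∑ t, ψ t (c t)) := by
          refine mul_le_mul_of_nonneg_left ?_ hp
          by_cases h : n * τ < ∑ t, ψ t (c t)
          · rw [ind_true h]
            apply Real.one_le_exp
            nlinarith
          · rw [ind_false h]
            exact (Real.exp_pos _).le
      _ = _ := by rw [Real.exp_add]; ring
  refine (Finset.sum_le_sum fun c _ => hpt c).trans ?_
  rw [← Finset.mul_sum, sum_prod_pi (fun t x => κ t x * Real.exp (l * ψ t x))]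
  have hone : ∀ t, ∑ x, κ t x * Real.exp (l * ψ t x) ≤ Real.exp ((l * M) ^ 2) := by
    intro t
    have hx : ∀ x, κ t x * Real.exp (l * ψ t x)
        ≤ κ t x * (1 + (l * M) ^ 2) + l * (κ t x * ψ t x) := by
      intro x
      have habs : |l * ψ t x| ≤ l * M := by
        rw [abs_mul, abs_of_pos hl0]
        exact mul_le_mul_of_nonneg_left (hψM t x) hl0.le
      have h1 := Real.abs_exp_sub_one_sub_id_le (habs.trans hlM)
      have h2 := (abs_le.1 h1).2
      have h3 : (l * ψ t x) ^ 2 ≤ (l * M) ^ 2 := by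
        rw [← sq_abs]
        exact pow_le_pow_left₀ (abs_nonneg _) habs 2
      have := mul_le_mul_of_nonneg_left
        (show Real.exp (l * ψ t x) ≤ 1 + (l * M) ^ 2 + l * ψ t x by linarith) (hκ t x)
      linarith
    refine (Finset.sum_le_sum fun x _ => hx x).trans ?_
    rw [Finset.sum_add_distrib, ← Finset.sum_mul, ← Finset.mul_sum, hκs, hψ]
    have := Real.add_one_le_exp ((l * M) ^ 2)
    linarith
  have hprod : ∏ t : Fin n, ∑ x, κ t x * Real.exp (l * ψ t x)
      ≤ Real.exp (n * (l * M) ^ 2) := by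
    refine (Finset.prod_le_prod (fun t _ => Finset.sum_nonneg fun x _ =>
      mul_nonneg (hκ t x) (Real.exp_pos _).le) (fun t _ => hone t)).trans ?_
    simp [← Real.exp_nat_mul]
  refine (mul_le_mul_of_nonneg_left hprod (Real.exp_pos _).le).trans ?_
  rw [← Real.exp_add]
  apply Real.exp_le_exp.2
  apply le_of_eq
  rw [hl]
  field_simp
  ring

lemma sum_Nocc {n : ℕ} {B : Type*} [Fintype B] (b : Fin n → B) (g : B → ℝ) :
    ∑ t, g (b t) = ∑ x, (Nocc x b : ℝ) * g x := by
  classical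
  rw [← Finset.sum_fiberwise Finset.univ b (fun t => g (b t))]
  refine Finset.sum_congr rfl fun x _ => ?_
  rw [Finset.sum_congr rfl (g := fun _ => g x)]
  · simp only [Finset.sum_const, nsmul_eq_mul, Nocc]
  · intro t ht
    simp at ht
    rw [ht]

lemma typ_mean {n : ℕ} (hn : 0 < n) {B : Type*} [Fintype B] (p0 : B → ℝ) (hp0 : IsPMF p0)
    (δ : ℝ) (hδ : 0 ≤ δ) (b : Fin n → B) (hb : b ∈ typical p0 δ n) (g : B → ℝ) (M : ℝ)
    (hg : ∀ x, |g x| ≤ M) :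
    |∑ t, g (b t) - n * ∑ x, p0 x * g x| ≤ n * (2 * δ * M) := by
  have hn' : (0 : ℝ) < n := by exact_mod_cast hn
  have hBne : Nonempty B := ⟨b ⟨0, hn⟩⟩
  have hB : (0 : ℝ) < Fintype.card B := by exact_mod_cast Fintype.card_pos
  have hM : 0 ≤ M := (abs_nonneg _).trans (hg hBne.some)
  have hsumN : ∑ x, (Nocc x b : ℝ) = n := by
    have := sum_Nocc b (fun _ => 1)
    simp at this
    exact this.symm
  have e1 : ∑ t, g (b t) - n * ∑ x, p0 x * g x
      = n * ∑ x, ((Nocc x b : ℝ) / n - p0 x) * g x := by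
    rw [sum_Nocc, Finset.mul_sum, Finset.mul_sum, ← Finset.sum_sub_distrib]
    refine Finset.sum_congr rfl fun x _ => ?_
    field_simp
  rw [e1, abs_mul, abs_of_pos hn']
  refine mul_le_mul_of_nonneg_left ?_ hn'.le
  have hD : ∀ x, |(Nocc x b : ℝ) / n - p0 x| ≤
      ((Nocc x b : ℝ) / n - p0 x) + 2 * (δ / Fintype.card B) := by
    intro x
    by_cases hx : p0 x = 0
    · rw [hx, sub_zero, abs_of_nonneg (by positivity)]
      have : 0 ≤ δ / Fintype.card B := by positivity
      linarith
    · have := hb x hx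
      have h2 := neg_abs_le ((Nocc x b : ℝ) / n - p0 x)
      linarith
  have hDs : ∑ x, |(Nocc x b : ℝ) / n - p0 x| ≤ 2 * δ := by
    refine (Finset.sum_le_sum fun x _ => hD x).trans ?_
    rw [Finset.sum_add_distrib, Finset.sum_sub_distrib, ← Finset.sum_div, hsumN, hp0.2,
      div_self hn'.ne']
    simp
    apply le_of_eq
    field_simp
  calc |∑ x, ((Nocc x b : ℝ) / n - p0 x) * g x|
      ≤ ∑ x, |((Nocc x b : ℝ) / n - p0 x) * g x| := Finset.abs_sum_le_sum_abs _ _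
    _ ≤ ∑ x, |(Nocc x b : ℝ) / n - p0 x| * M := by
        refine Finset.sum_le_sum fun x _ => ?_
        rw [abs_mul]
        exact mul_le_mul_of_nonneg_left (hg x) (abs_nonneg _)
    _ = (∑ x, |(Nocc x b : ℝ) / n - p0 x|) * M := by rw [Finset.sum_mul]
    _ ≤ 2 * δ * M := mul_le_mul_of_nonneg_right hDs hM

lemma conc {B C : Type*} [Fintype B] [Fintype C] (p0 : B → ℝ) (hp0 : IsPMF p0)
    (k : B → C → ℝ) (hk : ∀ b c, 0 ≤ k b c) (hks : ∀ b, ∑ c, k b c = 1)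
    (φ : B → C → ℝ) (τ : ℝ) (hτ : 0 < τ) :
    ∃ δ0 > (0 : ℝ), ∃ N : ℕ, ∀ n ≥ N, ∀ δ ≤ δ0, 0 < δ → ∀ b : Fin n → B, b ∈ typical p0 δ n →
      ∑ c : Fin n → C, (∏ t, k (b t) (c t)) *
        ind (¬ |∑ t, φ (b t) (c t) - n * ∑ x, p0 x * ∑ y, k x y * φ x y| ≤ n * τ) ≤ τ := by
  obtain ⟨M0, hM0, hφ⟩ : ∃ M0 : ℝ, 1 ≤ M0 ∧ ∀ x y, |φ x y| ≤ M0 := by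
    refine ⟨1 + ∑ x, ∑ y, |φ x y|, ?_, ?_⟩
    · have : 0 ≤ ∑ x, ∑ y, |φ x y| := by positivity
      linarith
    · intro x y
      have h1 := Finset.single_le_sum (f := fun x => ∑ y, |φ x y|)
        (fun i _ => Finset.sum_nonneg fun j _ => abs_nonneg _) (Finset.mem_univ x)
      have h2 := Finset.single_le_sum (f := fun y => |φ x y|)
        (fun j _ => abs_nonneg _) (Finset.mem_univ y)
      linarith
  set τ' : ℝ := min τ 1 with hτ'
  have hτ'0 : 0 < τ' := lt_min hτ one_pos
  have hτ'1 : τ' ≤ 1 := min_le_right _ _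
  have hτ'τ : τ' ≤ τ := min_le_left _ _
  set M : ℝ := 2 * M0 with hM
  set e : ℝ := (τ' / 2) ^ 2 / (4 * M ^ 2) with he
  have he0 : 0 < e := by positivity
  have hlim : Filter.Tendsto (fun n : ℕ => 2 * Real.exp (-(n * e))) Filter.atTop (nhds 0) := by
    have h1 : Filter.Tendsto (fun n : ℕ => (n : ℝ) * e) Filter.atTop Filter.atTop :=
      tendsto_natCast_atTop_atTop.atTop_mul_const he0
    have h2 := (Real.tendsto_exp_neg_atTop_nhds_zero.comp h1).const_mul 2
    simpa using h2
  obtain ⟨N, hN⟩ := Filter.eventually_atTop.1 (hlim.eventually (gt_mem_nhds hτ))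
  refine ⟨τ' / (4 * M0), by positivity, N + 1, ?_⟩
  intro n hn δ hδ hδ0 b hb
  have hn0 : 0 < n := by omega
  have hn' : (0 : ℝ) < n := by exact_mod_cast hn0
  have hNn := hN n (by omega)
  set φb : B → ℝ := fun x => ∑ y, k x y * φ x y with hφb
  have hφbM : ∀ x, |φb x| ≤ M0 := by
    intro x
    calc |φb x| ≤ ∑ y, |k x y * φ x y| := Finset.abs_sum_le_sum_abs _ _
      _ ≤ ∑ y, k x y * M0 := by
          refine Finset.sum_le_sum fun y _ => ?_
          rw [abs_mul, abs_of_nonneg (hk x y)]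
          exact mul_le_mul_of_nonneg_left (hφ x y) (hk x y)
      _ = M0 := by rw [← Finset.sum_mul, hks, one_mul]
  have hmean := typ_mean hn0 p0 hp0 δ hδ0.le b hb φb M0 hφbM
  have hmean' : |∑ t, φb (b t) - n * ∑ x, p0 x * φb x| ≤ n * (τ' / 2) := by
    refine hmean.trans (mul_le_mul_of_nonneg_left ?_ hn'.le)
    rw [le_div_iff₀ (by positivity)] at hδ
    linarith
  have hψM : ∀ t x, |φ (b t) x - φb (b t)| ≤ M := by
    intro t x
    have := abs_sub (φ (b t) x) (φb (b t))
    have h1 := hφ (b t) x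
    have h2 := hφbM (b t)
    linarith
  have hψ0 : ∀ t, ∑ x, k (b t) x * (φ (b t) x - φb (b t)) = 0 := by
    intro t
    simp_rw [mul_sub]
    rw [Finset.sum_sub_distrib, ← Finset.sum_mul, hks]
    simp [hφb]
  have c1 := chernoff (fun t => k (b t)) (fun t x => φ (b t) x - φb (b t)) (fun t => hk (b t))
    (fun t => hks (b t)) hψ0 M (by linarith) hψM (τ' / 2) (by positivity) (by linarith)
  have c2 := chernoff (fun t => k (b t)) (fun t x => -(φ (b t) x - φb (b t))) (fun t => hk (b t))
    (fun t => hks (b t)) (fun t => by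
      simp_rw [mul_neg]
      rw [Finset.sum_neg_distrib, hψ0 t, neg_zero]) M (by linarith)
    (fun t x => by rw [abs_neg]; exact hψM t x) (τ' / 2) (by positivity) (by linarith)
  have hle : ∀ c : Fin n → C,
      (∏ t, k (b t) (c t)) *
        ind (¬ |∑ t, φ (b t) (c t) - n * ∑ x, p0 x * φb x| ≤ n * τ)
      ≤ (∏ t, k (b t) (c t)) * ind (n * (τ' / 2) < ∑ t, (φ (b t) (c t) - φb (b t)))
       + (∏ t, k (b t) (c t)) * ind (n * (τ' / 2) < ∑ t, -(φ (b t) (c t) - φb (b t))) := by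
    intro c
    rw [← mul_add]
    refine mul_le_mul_of_nonneg_left ?_ (Finset.prod_nonneg fun t _ => hk _ _)
    by_cases h : |∑ t, φ (b t) (c t) - n * ∑ x, p0 x * φb x| ≤ n * τ
    · rw [ind_false (not_not.2 h)]
      exact add_nonneg (ind_nonneg _) (ind_nonneg _)
    · rw [ind_true h]
      push Not at h
      have hnτ : n * τ' ≤ n * τ := mul_le_mul_of_nonneg_left hτ'τ hn'.le
      have h' : n * (τ' / 2) < |∑ t, (φ (b t) (c t) - φb (b t))| := by
        rw [Finset.sum_sub_distrib]
        have := abs_sub_le (∑ t, φ (b t) (c t)) (∑ t, φb (b t)) (n * ∑ x, p0 x * φb x)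
        linarith
      rcases lt_abs.1 h' with h1 | h1
      · rw [ind_true h1]
        have := ind_nonneg (n * (τ' / 2) < ∑ t, -(φ (b t) (c t) - φb (b t)))
        linarith
      · have h2 : n * (τ' / 2) < ∑ t, -(φ (b t) (c t) - φb (b t)) := by
          rw [Finset.sum_neg_distrib]; exact h1
        rw [ind_true h2]
        have := ind_nonneg (n * (τ' / 2) < ∑ t, (φ (b t) (c t) - φb (b t)))
        linarith
  refine (Finset.sum_le_sum fun c _ => hle c).trans ?_
  rw [Finset.sum_add_distrib]
  have := add_le_add c1 c2
  linarith

end Conc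

section Ent

variable {Ω : Type*} [Fintype Ω]

lemma dist_nonneg' (w : Ω → ℝ) (hw : ∀ ω, 0 ≤ w ω) {α : Type*} [Fintype α] (X : Ω → α) (a : α) :
    0 ≤ IT.dist w X a := by
  unfold IT.dist
  refine Finset.sum_nonneg fun ω _ => ?_
  split_ifs
  · exact hw ω
  · exact le_rfl

lemma dist_sum_mul (w : Ω → ℝ) {α : Type*} [Fintype α] (X : Ω → α) (g : α → ℝ) :
    ∑ a, IT.dist w X a * g a = ∑ ω, w ω * g (X ω) := by
  classical
  unfold IT.dist
  simp_rw [Finset.sum_mul]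
  rw [Finset.sum_comm]
  refine Finset.sum_congr rfl fun ω _ => ?_
  simp [ite_mul]

lemma dist_sum_one (w : Ω → ℝ) (hw : IsPMF w) {α : Type*} [Fintype α] (X : Ω → α) :
    ∑ a, IT.dist w X a = 1 := by
  have := dist_sum_mul w X (fun _ => 1)
  simpa [hw.2] using this

lemma H_eq (w : Ω → ℝ) {α : Type*} [Fintype α] (X : Ω → α) :
    IT.H w X = -∑ ω, w ω * Real.logb 2 (IT.dist w X (X ω)) := by
  unfold IT.H
  rw [dist_sum_mul w X (fun a => Real.logb 2 (IT.dist w X a))]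

lemma dist_congr' (w : Ω → ℝ) {α β : Type*} [Fintype α] [Fintype β] (X : Ω → α) (Y : Ω → β)
    (x : α) (y : β) (h : ∀ ω, X ω = x ↔ Y ω = y) :
    IT.dist w X x = IT.dist w Y y := by
  unfold IT.dist
  refine Finset.sum_congr rfl fun ω _ => ?_
  by_cases hx : X ω = x
  · rw [if_pos hx, if_pos ((h ω).1 hx)]
  · rw [if_neg hx, if_neg (fun hy => hx ((h ω).2 hy))]

lemma H_congr (w : Ω → ℝ) {α β : Type*} [Fintype α] [Fintype β] (X : Ω → α) (Y : Ω → β)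
    (h : ∀ ω ω', X ω = X ω' ↔ Y ω = Y ω') : IT.H w X = IT.H w Y := by
  rw [H_eq, H_eq]
  congr 1
  refine Finset.sum_congr rfl fun ω _ => ?_
  rw [dist_congr' w X Y (X ω) (Y ω) (fun ω' => h ω' ω)]

lemma dist_marg (w : Ω → ℝ) {α β : Type*} [Fintype α] [Fintype β] (X : Ω → α) (Y : Ω → β)
    (y : β) : ∑ x, IT.dist w (fun ω => (X ω, Y ω)) (x, y) = IT.dist w Y y := by
  classical
  unfold IT.dist
  rw [Finset.sum_comm]
  refine Finset.sum_congr rfl fun ω _ => ?_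
  by_cases h : Y ω = y <;> simp [h, Prod.ext_iff]

lemma dist_pair_le (w : Ω → ℝ) (hw : ∀ ω, 0 ≤ w ω) {α β : Type*} [Fintype α] [Fintype β]
    (X : Ω → α) (Y : Ω → β) (x : α) (y : β) :
    IT.dist w (fun ω => (X ω, Y ω)) (x, y) ≤ IT.dist w Y y := by
  rw [← dist_marg w X Y y]
  exact Finset.single_le_sum (f := fun x => IT.dist w (fun ω => (X ω, Y ω)) (x, y))
    (fun i _ => dist_nonneg' w hw _ _) (Finset.mem_univ x)

lemma dist_pos' (w : Ω → ℝ) (hw : ∀ ω, 0 ≤ w ω) {α : Type*} [Fintype α] (X : Ω → α) (ω : Ω)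
    (h : 0 < w ω) : 0 < IT.dist w X (X ω) := by
  classical
  have h1 := Finset.single_le_sum (f := fun ω' => if X ω' = X ω then w ω' else 0)
    (fun i _ => by
      show 0 ≤ (if X i = X ω then w i else 0)
      split_ifs
      · exact hw i
      · exact le_rfl) (Finset.mem_univ ω)
  simp only [if_true] at h1
  unfold IT.dist
  refine lt_of_lt_of_le h (h1.trans (le_of_eq ?_))
  refine Finset.sum_congr rfl fun i _ => ?_
  congr

lemma gibbs_term {f g : ℝ} (hf : 0 ≤ f) (hg : 0 ≤ g) (hfg : f = 0 → g = 0) :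
    g * (Real.log f - Real.log g) ≤ f - g := by
  rcases hg.eq_or_lt with h | h
  · simp [← h, hf]
  · have hf0 : 0 < f := lt_of_le_of_ne hf fun h0 => h.ne' (hfg h0.symm)
    have h1 := Real.log_le_sub_one_of_pos (div_pos hf0 h)
    rw [Real.log_div hf0.ne' h.ne'] at h1
    have h2 := mul_le_mul_of_nonneg_left h1 hg
    have h3 : g * (f / g - 1) = f - g := by field_simp
    linarith

lemma gibbs_eq {f g : ℝ} (hf : 0 ≤ f) (hg : 0 ≤ g) (hfg : f = 0 → g = 0)
    (h : g * (Real.log f - Real.log g) = f - g) : f = g := by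
  rcases hg.eq_or_lt with h0 | h0
  · simp [← h0] at h
    rw [← h0, ← h]
  · have hf0 : 0 < f := lt_of_le_of_ne hf fun h1 => h0.ne' (hfg h1.symm)
    by_contra hne
    have hne' : f / g ≠ 1 := by
      intro h1
      rw [div_eq_one_iff_eq h0.ne'] at h1
      exact hne h1
    have h1 := Real.log_lt_sub_one_of_pos (div_pos hf0 h0) hne'
    rw [Real.log_div hf0.ne' h0.ne'] at h1
    have h2 := mul_lt_mul_of_pos_left h1 h0
    have h3 : g * (f / g - 1) = f - g := by field_simp
    linarith

variable {α β γ : Type*} [Fintype α] [Fintype β] [Fintype γ]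

/-- Auxiliary: the conditionally independent version of the joint law. -/
def ciLaw (w : Ω → ℝ) (X : Ω → α) (Y : Ω → β) (Z : Ω → γ) (v : α × β × γ) : ℝ :=
  IT.dist w (fun ω => (X ω, Z ω)) (v.1, v.2.2) * IT.dist w (fun ω => (Y ω, Z ω)) (v.2.1, v.2.2)
    / IT.dist w Z v.2.2

lemma ciLaw_nonneg (w : Ω → ℝ) (hw : ∀ ω, 0 ≤ w ω) (X : Ω → α) (Y : Ω → β) (Z : Ω → γ)
    (v : α × β × γ) : 0 ≤ ciLaw w X Y Z v :=
  div_nonneg (mul_nonneg (dist_nonneg' w hw _ _) (dist_nonneg' w hw _ _)) (dist_nonneg' w hw _ _)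

lemma ciLaw_sum (w : Ω → ℝ) (hw : IsPMF w) (X : Ω → α) (Y : Ω → β) (Z : Ω → γ) :
    ∑ v, ciLaw w X Y Z v = 1 := by
  have h1 : ∑ v, ciLaw w X Y Z v = ∑ z, (∑ x, IT.dist w (fun ω => (X ω, Z ω)) (x, z)) *
      (∑ y, IT.dist w (fun ω => (Y ω, Z ω)) (y, z)) / IT.dist w Z z := by
    simp only [Fintype.sum_prod_type, ciLaw]
    rw [Finset.sum_congr rfl fun x _ => Finset.sum_comm, Finset.sum_comm]
    refine Finset.sum_congr rfl fun z _ => ?_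
    rw [Finset.sum_mul_sum, Finset.sum_div]
    refine Finset.sum_congr rfl fun x _ => ?_
    rw [Finset.sum_div]
  rw [h1, ← dist_sum_one w hw Z]
  refine Finset.sum_congr rfl fun z _ => ?_
  rw [dist_marg, dist_marg, mul_self_div_self]

lemma ciLaw_ac (w : Ω → ℝ) (hw : ∀ ω, 0 ≤ w ω) (X : Ω → α) (Y : Ω → β) (Z : Ω → γ)
    (v : α × β × γ) (h : ciLaw w X Y Z v = 0) :
    IT.dist w (fun ω => (X ω, Y ω, Z ω)) v = 0 := by
  obtain ⟨x, y, z⟩ := v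
  have n0 := dist_nonneg' w hw (fun ω => (X ω, Y ω, Z ω)) (x, y, z)
  have l1 := dist_pair_le w hw X (fun ω => (Y ω, Z ω)) x (y, z)
  have l2 : IT.dist w (fun ω => (X ω, Y ω, Z ω)) (x, y, z)
      ≤ IT.dist w (fun ω => (X ω, Z ω)) (x, z) := by
    have := dist_pair_le w hw Y (fun ω => (X ω, Z ω)) y (x, z)
    rw [dist_congr' w (fun ω => (Y ω, X ω, Z ω)) (fun ω => (X ω, Y ω, Z ω)) (y, x, z) (x, y, z)
      (fun ω => by simp only [Prod.mk.injEq]; tauto)] at this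
    exact this
  have l3 := dist_pair_le w hw Y Z y z
  simp only [ciLaw, div_eq_zero_iff, mul_eq_zero] at h
  rcases h with (h | h) | h <;> linarith

lemma condMutInfo_eq (w : Ω → ℝ) (hw : IsPMF w) (X : Ω → α) (Y : Ω → β) (Z : Ω → γ) :
    IT.condMutInfo w X Y Z = -(∑ v, IT.dist w (fun ω => (X ω, Y ω, Z ω)) v *
      (Real.log (ciLaw w X Y Z v) - Real.log (IT.dist w (fun ω => (X ω, Y ω, Z ω)) v)))
      / Real.log 2 := by
  rw [dist_sum_mul w (fun ω => (X ω, Y ω, Z ω)) (fun v => Real.log (ciLaw w X Y Z v) -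
    Real.log (IT.dist w (fun ω => (X ω, Y ω, Z ω)) v))]
  unfold IT.condMutInfo IT.condH
  simp only [H_eq, Real.logb]
  have hl2 : Real.log 2 ≠ 0 := (Real.log_pos (by norm_num)).ne'
  rw [eq_div_iff hl2]
  simp_rw [← mul_div_assoc, ← Finset.sum_div]
  have : ∀ ω, w ω * (Real.log (ciLaw w X Y Z (X ω, Y ω, Z ω)) -
      Real.log (IT.dist w (fun ω => (X ω, Y ω, Z ω)) (X ω, Y ω, Z ω)))
      = w ω * Real.log (IT.dist w (fun ω => (X ω, Z ω)) (X ω, Z ω))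
      + w ω * Real.log (IT.dist w (fun ω => (Y ω, Z ω)) (Y ω, Z ω))
      - w ω * Real.log (IT.dist w Z (Z ω))
      - w ω * Real.log (IT.dist w (fun ω => (X ω, Y ω, Z ω)) (X ω, Y ω, Z ω)) := by
    intro ω
    rcases (hw.1 ω).eq_or_lt with h | h
    · simp [← h]
    · have a1 := dist_pos' w hw.1 (fun ω => (X ω, Z ω)) ω h
      have a2 := dist_pos' w hw.1 (fun ω => (Y ω, Z ω)) ω h
      have a3 := dist_pos' w hw.1 Z ω h
      simp only [ciLaw]
      rw [Real.log_div (by positivity) a3.ne', Real.log_mul a1.ne' a2.ne']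
      ring
  simp_rw [this]
  rw [Finset.sum_sub_distrib, Finset.sum_sub_distrib, Finset.sum_add_distrib]
  field_simp
  ring

lemma condMutInfo_nonneg (w : Ω → ℝ) (hw : IsPMF w) (X : Ω → α) (Y : Ω → β) (Z : Ω → γ) :
    0 ≤ IT.condMutInfo w X Y Z := by
  rw [condMutInfo_eq w hw]
  refine div_nonneg ?_ (Real.log_pos (by norm_num)).le
  have := Finset.sum_le_sum (s := Finset.univ) fun v _ => gibbs_term (ciLaw_nonneg w hw.1 X Y Z v)
    (dist_nonneg' w hw.1 (fun ω => (X ω, Y ω, Z ω)) v) (ciLaw_ac w hw.1 X Y Z v)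
  rw [Finset.sum_sub_distrib, ciLaw_sum w hw, dist_sum_one w hw] at this
  linarith

lemma condMutInfo_zero (w : Ω → ℝ) (hw : IsPMF w) (X : Ω → α) (Y : Ω → β) (Z : Ω → γ)
    (h : IT.condMutInfo w X Y Z = 0) (v : α × β × γ) :
    ciLaw w X Y Z v = IT.dist w (fun ω => (X ω, Y ω, Z ω)) v := by
  rw [condMutInfo_eq w hw, div_eq_zero_iff] at h
  have hl2 : Real.log 2 ≠ 0 := (Real.log_pos (by norm_num)).ne'
  have h0 := neg_eq_zero.1 (h.resolve_right hl2)
  have hle : ∀ v ∈ Finset.univ, _ ≤ _ := fun v _ => gibbs_term (ciLaw_nonneg w hw.1 X Y Z v)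
    (dist_nonneg' w hw.1 (fun ω => (X ω, Y ω, Z ω)) v) (ciLaw_ac w hw.1 X Y Z v)
  have heq := (Finset.sum_eq_sum_iff_of_le hle).1 (by
    rw [h0, Finset.sum_sub_distrib, ciLaw_sum w hw, dist_sum_one w hw, sub_self])
  exact gibbs_eq (ciLaw_nonneg w hw.1 X Y Z v)
    (dist_nonneg' w hw.1 (fun ω => (X ω, Y ω, Z ω)) v) (ciLaw_ac w hw.1 X Y Z v)
    (heq v (Finset.mem_univ v))

open Classical in
/-- Conditional kernel of `X` given `Y`. -/
def ck (w : Ω → ℝ) (X : Ω → α) (Y : Ω → β) (y : β) (x : α) : ℝ :=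
  if IT.dist w Y y = 0 then 1 / Fintype.card α
  else IT.dist w (fun ω => (X ω, Y ω)) (x, y) / IT.dist w Y y

lemma ck_nonneg (w : Ω → ℝ) (hw : ∀ ω, 0 ≤ w ω) (X : Ω → α) (Y : Ω → β) (y : β) (x : α) :
    0 ≤ ck w X Y y x := by
  unfold ck
  split_ifs
  · positivity
  · exact div_nonneg (dist_nonneg' w hw _ _) (dist_nonneg' w hw _ _)

lemma ck_sum [Nonempty α] (w : Ω → ℝ) (X : Ω → α) (Y : Ω → β) (y : β) :
    ∑ x, ck w X Y y x = 1 := by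
  unfold ck
  split_ifs with h
  · simp
  · rw [← Finset.sum_div, dist_marg, div_self h]

lemma ck_mul (w : Ω → ℝ) (hw : ∀ ω, 0 ≤ w ω) (X : Ω → α) (Y : Ω → β) (y : β) (x : α) :
    ck w X Y y x * IT.dist w Y y = IT.dist w (fun ω => (X ω, Y ω)) (x, y) := by
  unfold ck
  split_ifs with h
  · have h1 := dist_pair_le w hw X Y x y
    have h2 := dist_nonneg' w hw (fun ω => (X ω, Y ω)) (x, y)
    rw [h] at h1 ⊢
    linarith
  · rw [div_mul_cancel₀ _ h]

lemma ck_condH (w : Ω → ℝ) (hw : ∀ ω, 0 ≤ w ω) (X : Ω → α) (Y : Ω → β) :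
    ∑ ω, w ω * (-Real.logb 2 (ck w X Y (Y ω) (X ω))) = IT.condH w X Y := by
  unfold IT.condH
  rw [H_eq, H_eq, neg_sub_neg, ← Finset.sum_sub_distrib]
  refine Finset.sum_congr rfl fun ω _ => ?_
  rcases (hw ω).eq_or_lt with h | h
  · simp [← h]
  · have a1 := dist_pos' w hw (fun ω => (X ω, Y ω)) ω h
    have a3 := dist_pos' w hw Y ω h
    unfold ck
    rw [if_neg a3.ne', Real.logb_div a1.ne' a3.ne']
    ring

lemma ck_pos (w : Ω → ℝ) (hw : ∀ ω, 0 ≤ w ω) (X : Ω → α) (Y : Ω → β) (ω : Ω) (h : 0 < w ω) :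
    0 < ck w X Y (Y ω) (X ω) := by
  have a1 := dist_pos' w hw (fun ω => (X ω, Y ω)) ω h
  have a3 := dist_pos' w hw Y ω h
  unfold ck
  rw [if_neg a3.ne']
  exact div_pos a1 a3

lemma ck_markov (w : Ω → ℝ) (hw : IsPMF w) (X : Ω → α) (Y : Ω → β) (Z : Ω → γ)
    (h : IT.condMutInfo w X Y Z = 0) (x : α) (y : β) (z : γ) :
    IT.dist w (fun ω => (X ω, Y ω, Z ω)) (x, y, z)
      = ck w X Z z x * IT.dist w (fun ω => (Y ω, Z ω)) (y, z) := by
  rw [← condMutInfo_zero w hw X Y Z h]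
  simp only [ciLaw]
  have h1 := dist_pair_le w hw.1 Y Z y z
  have h2 := dist_nonneg' w hw.1 (fun ω => (Y ω, Z ω)) (y, z)
  by_cases h0 : IT.dist w Z z = 0
  · have : IT.dist w (fun ω => (Y ω, Z ω)) (y, z) = 0 := by linarith
    simp [this]
  · unfold ck
    rw [if_neg h0]
    ring

/-- Smoothed conditional kernel. -/
def sk (δ : ℝ) (w : Ω → ℝ) (X : Ω → α) (Y : Ω → β) (y : β) (x : α) : ℝ :=
  (2 : ℝ) ^ (-δ) * ck w X Y y x + (1 - (2 : ℝ) ^ (-δ)) * (1 / Fintype.card α)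

lemma two_rpow_neg_lt {δ : ℝ} (hδ : 0 < δ) : (2 : ℝ) ^ (-δ) < 1 :=
  Real.rpow_lt_one_of_one_lt_of_neg (by norm_num) (by linarith)

lemma sk_pos [Nonempty α] {δ : ℝ} (hδ : 0 < δ) (w : Ω → ℝ) (hw : ∀ ω, 0 ≤ w ω)
    (X : Ω → α) (Y : Ω → β) (y : β) (x : α) : 0 < sk δ w X Y y x := by
  unfold sk
  have h1 := ck_nonneg w hw X Y y x
  have h2 := two_rpow_neg_lt hδ
  have h3 : (0 : ℝ) < Fintype.card α := by exact_mod_cast Fintype.card_pos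
  have h4 : 0 < (2 : ℝ) ^ (-δ) := by positivity
  have h5 : 0 < 1 - (2 : ℝ) ^ (-δ) := by linarith
  positivity

lemma sk_sum [Nonempty α] (δ : ℝ) (w : Ω → ℝ) (X : Ω → α) (Y : Ω → β) (y : β) :
    ∑ x, sk δ w X Y y x = 1 := by
  unfold sk
  rw [Finset.sum_add_distrib, ← Finset.mul_sum, ck_sum]
  have hc : (Fintype.card α : ℝ) ≠ 0 := by exact_mod_cast Fintype.card_pos.ne'
  simp only [Finset.sum_const, Finset.card_univ, nsmul_eq_mul]
  field_simp
  ring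

lemma sk_condH [Nonempty α] {δ : ℝ} (hδ : 0 < δ) (w : Ω → ℝ) (hw : IsPMF w)
    (X : Ω → α) (Y : Ω → β) :
    ∑ ω, w ω * (-Real.logb 2 (sk δ w X Y (Y ω) (X ω))) ≤ IT.condH w X Y + δ := by
  rw [← ck_condH w hw.1]
  have h1 : ∑ ω, w ω * (-Real.logb 2 (ck w X Y (Y ω) (X ω))) + δ
      = ∑ ω, w ω * (-Real.logb 2 (ck w X Y (Y ω) (X ω)) + δ) := by
    simp_rw [mul_add]
    rw [Finset.sum_add_distrib, ← Finset.sum_mul, hw.2, one_mul]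
  rw [h1]
  refine Finset.sum_le_sum fun ω _ => ?_
  rcases (hw.1 ω).eq_or_lt with h | h
  · simp [← h]
  · refine mul_le_mul_of_nonneg_left ?_ h.le
    have hc := ck_pos w hw.1 X Y ω h
    have h4 : 0 < (2 : ℝ) ^ (-δ) := by positivity
    have hle : (2 : ℝ) ^ (-δ) * ck w X Y (Y ω) (X ω) ≤ sk δ w X Y (Y ω) (X ω) := by
      unfold sk
      have h2 := two_rpow_neg_lt hδ
      have : 0 ≤ (1 - (2 : ℝ) ^ (-δ)) * (1 / Fintype.card α) :=
        mul_nonneg (by linarith) (by positivity)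
      linarith
    have := Real.logb_le_logb_of_le (b := 2) (by norm_num) (by positivity) hle
    rw [Real.logb_mul h4.ne' hc.ne', Real.logb_rpow (by norm_num) (by norm_num)] at this
    linarith

end Ent

section Cnt

lemma two_rpow_eq_prod {n : ℕ} (f : Fin n → ℝ) (hf : ∀ t, 0 < f t) :
    (2 : ℝ) ^ (-∑ t, -Real.logb 2 (f t)) = ∏ t, f t := by
  rw [Finset.sum_neg_distrib, neg_neg, ← Real.logb_prod _ _ (fun t _ => (hf t).ne')]
  exact Real.rpow_logb (by norm_num) (by norm_num) (Finset.prod_pos fun t _ => hf t)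

lemma count_le {n : ℕ} {C : Type*} [Fintype C] (F : Fin n → C → ℝ) (hF : ∀ t x, 0 < F t x)
    (hs : ∀ t, ∑ x, F t x = 1) (h : ℝ) :
    ∑ c : Fin n → C, ind (∑ t, -Real.logb 2 (F t (c t)) ≤ h) ≤ (2 : ℝ) ^ h := by
  have h1 : ∀ c : Fin n → C, ind (∑ t, -Real.logb 2 (F t (c t)) ≤ h)
      ≤ (2 : ℝ) ^ h * ∏ t, F t (c t) := by
    intro c
    by_cases hc : ∑ t, -Real.logb 2 (F t (c t)) ≤ h
    · rw [ind_true hc, ← two_rpow_eq_prod _ (fun t => hF t (c t)), ← Real.rpow_add (by norm_num)]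
      exact Real.one_le_rpow (by norm_num) (by linarith)
    · rw [ind_false hc]
      exact mul_nonneg (by positivity) (Finset.prod_nonneg fun t _ => (hF t _).le)
  refine (Finset.sum_le_sum fun c _ => h1 c).trans ?_
  rw [← Finset.mul_sum, sum_prod_pi]
  simp [hs]

lemma prod_le_rpow {n : ℕ} (f : Fin n → ℝ) (hf : ∀ t, 0 ≤ f t) (h : ℝ)
    (hh : h ≤ ∑ t, -Real.logb 2 (f t)) : ∏ t, f t ≤ (2 : ℝ) ^ (-h) := by
  by_cases h0 : ∀ t, 0 < f t
  · rw [← two_rpow_eq_prod f h0]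
    exact Real.rpow_le_rpow_of_exponent_le (by norm_num) (by linarith)
  · push Not at h0
    obtain ⟨t, ht⟩ := h0
    rw [Finset.prod_eq_zero (Finset.mem_univ t) (le_antisymm ht (hf t))]
    positivity

end Cnt

section Ent

variable {Ω : Type*} [Fintype Ω] {A1 A2 A3 B1 B2 C1 C2 : Type*}
  [Fintype A1] [Fintype A2] [Fintype A3] [Fintype B1] [Fintype B2] [Fintype C1] [Fintype C2]

lemma ent_a (w : Ω → ℝ) (hw : IsPMF w) (X1 : Ω → A1) (X2 : Ω → A2) (U1 : Ω → B1) (V1 : Ω → C1) :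
    IT.condH w U1 (fun a => (X2 a, V1 a)) - IT.condH w U1 (fun a => (X1 a, V1 a))
      ≤ IT.condMutInfo w X1 U1 (fun a => (X2 a, V1 a)) := by
  have h := condMutInfo_nonneg w hw U1 X2 (fun a => (X1 a, V1 a))
  unfold IT.condMutInfo IT.condH at *
  have e1 := H_congr w (fun a => (X1 a, (X2 a, V1 a))) (fun a => (X2 a, (X1 a, V1 a)))
    (fun a b => by simp only [Prod.mk.injEq]; tauto)
  have e2 := H_congr w (fun a => (X1 a, (U1 a, (X2 a, V1 a))))
    (fun a => (U1 a, (X2 a, (X1 a, V1 a)))) (fun a b => by simp only [Prod.mk.injEq]; tauto)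
  linarith

lemma ent_b (w : Ω → ℝ) (hw : IsPMF w) (X2 : Ω → A2) (X3 : Ω → A3) (U1 : Ω → B1) (U2 : Ω → B2)
    (V1 : Ω → C1) (V2 : Ω → C2) :
    IT.condH w U2 (fun a => (X3 a, V1 a, V2 a, U1 a)) - IT.condH w U2 (fun a => (U1 a, X2 a, V1 a))
      ≤ IT.condMutInfo w X2 U2 (fun a => (X3 a, V1 a, V2 a, U1 a)) := by
  have h := condMutInfo_nonneg w hw U2 (fun a => (X3 a, V2 a)) (fun a => (U1 a, X2 a, V1 a))
  unfold IT.condMutInfo IT.condH at *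
  have e1 := H_congr w (fun a => (X2 a, X3 a, V1 a, V2 a, U1 a))
    (fun a => ((X3 a, V2 a), U1 a, X2 a, V1 a))
    (fun a b => by simp only [Prod.mk.injEq]; tauto)
  have e2 := H_congr w (fun a => (X2 a, U2 a, X3 a, V1 a, V2 a, U1 a))
    (fun a => (U2 a, (X3 a, V2 a), U1 a, X2 a, V1 a))
    (fun a b => by simp only [Prod.mk.injEq]; tauto)
  linarith

lemma ent_c (w : Ω → ℝ) (X1 : Ω → A1) (X2 : Ω → A2) (X3 : Ω → A3)
    (U1 : Ω → B1) (U2 : Ω → B2) (V1 : Ω → C1) (V2 : Ω → C2)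
    (h1 : IT.condMutInfo w U1 (fun a => (X2 a, X3 a, V2 a)) (fun a => (X1 a, V1 a)) = 0)
    (h2 : IT.condMutInfo w U2 (fun a => (X1 a, X3 a, V2 a)) (fun a => (U1 a, X2 a, V1 a)) = 0) :
    IT.condH w (fun a => (U1 a, U2 a)) (fun a => (X3 a, V1 a, V2 a))
      - IT.condH w U1 (fun a => (X1 a, V1 a)) - IT.condH w U2 (fun a => (U1 a, X2 a, V1 a))
      = IT.condMutInfo w (fun a => (X1 a, X2 a)) (fun a => (U1 a, U2 a))
        (fun a => (X3 a, V1 a, V2 a)) := by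
  unfold IT.condMutInfo IT.condH at *
  have e1 := H_congr w (fun a => ((X1 a, X2 a), X3 a, V1 a, V2 a))
    (fun a => ((X2 a, X3 a, V2 a), X1 a, V1 a))
    (fun a b => by simp only [Prod.mk.injEq]; tauto)
  have e2 := H_congr w (fun a => ((X1 a, X2 a), (U1 a, U2 a), X3 a, V1 a, V2 a))
    (fun a => (U2 a, (X1 a, X3 a, V2 a), U1 a, X2 a, V1 a))
    (fun a b => by simp only [Prod.mk.injEq]; tauto)
  have e3 := H_congr w (fun a => ((X1 a, X3 a, V2 a), U1 a, X2 a, V1 a))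
    (fun a => (U1 a, (X2 a, X3 a, V2 a), X1 a, V1 a))
    (fun a b => by simp only [Prod.mk.injEq]; tauto)
  linarith

end Ent

section Multi

lemma multi_conc {B C ι : Type*} [Fintype B] [Fintype C] [Fintype ι] (p0 : B → ℝ) (hp0 : IsPMF p0)
    (k : B → C → ℝ) (hk : ∀ b c, 0 ≤ k b c) (hks : ∀ b, ∑ c, k b c = 1)
    (φ : ι → B → C → ℝ) (τ : ℝ) (hτ : 0 < τ) :
    ∃ δ0 > (0 : ℝ), ∃ N : ℕ, ∀ n ≥ N, ∀ b : Fin n → B, b ∈ typical p0 δ0 n →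
      1 - Fintype.card ι * τ ≤ ∑ c : Fin n → C, (∏ t, k (b t) (c t)) *
        ind (∀ i, |∑ t, φ i (b t) (c t) - n * ∑ x, p0 x * ∑ y, k x y * φ i x y| ≤ n * τ) := by
  classical
  choose d hd N hN using fun i => conc p0 hp0 k hk hks (φ i) τ hτ
  obtain ⟨δ0, hδ0, hle⟩ : ∃ δ0 > (0 : ℝ), ∀ i, δ0 ≤ d i := by
    by_cases hι : Nonempty ι
    · obtain ⟨i0, hi0⟩ := Finite.exists_min d
      exact ⟨d i0, hd i0, hi0⟩
    · exact ⟨1, one_pos, fun i => absurd ⟨i⟩ hι⟩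
  refine ⟨δ0, hδ0, ∑ i, N i, fun n hn b hb => ?_⟩
  have hone : ∑ c : Fin n → C, ∏ t, k (b t) (c t) = 1 := by
    rw [sum_prod_pi]
    simp [hks]
  have hb1 : ∀ i, _ ≤ τ := fun i => hN i n
    ((Finset.single_le_sum (f := N) (fun _ _ => Nat.zero_le _) (Finset.mem_univ i)).trans hn)
    δ0 (hle i) hδ0 b hb
  have hb2 := Finset.sum_le_sum (s := Finset.univ) fun i _ => hb1 i
  rw [Finset.sum_const, Finset.card_univ, nsmul_eq_mul, Finset.sum_comm] at hb2
  have key : ∀ c : Fin n → C, (∏ t, k (b t) (c t)) - ∑ i, (∏ t, k (b t) (c t)) *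
        ind (¬ |∑ t, φ i (b t) (c t) - n * ∑ x, p0 x * ∑ y, k x y * φ i x y| ≤ n * τ)
      ≤ (∏ t, k (b t) (c t)) *
        ind (∀ i, |∑ t, φ i (b t) (c t) - n * ∑ x, p0 x * ∑ y, k x y * φ i x y| ≤ n * τ) := by
    intro c
    have hnn : 0 ≤ ∏ t, k (b t) (c t) := Finset.prod_nonneg fun t _ => hk _ _
    by_cases h : ∀ i, |∑ t, φ i (b t) (c t) - n * ∑ x, p0 x * ∑ y, k x y * φ i x y| ≤ n * τ
    · rw [ind_true h, mul_one, sub_le_self_iff]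
      exact Finset.sum_nonneg fun i _ => mul_nonneg hnn (ind_nonneg _)
    · rw [ind_false h, mul_zero, sub_nonpos]
      rw [not_forall] at h
      obtain ⟨i, hi⟩ := h
      refine le_trans (le_of_eq ?_) (Finset.single_le_sum (f := fun i => (∏ t, k (b t) (c t)) *
        ind (¬ |∑ t, φ i (b t) (c t) - n * ∑ x, p0 x * ∑ y, k x y * φ i x y| ≤ n * τ))
        (fun i _ => mul_nonneg hnn (ind_nonneg _)) (Finset.mem_univ i))
      simp only [ind_true hi, mul_one]
  have := Finset.sum_le_sum (s := Finset.univ) fun c _ => key c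
  rw [Finset.sum_sub_distrib, hone] at this
  linarith

end Multi

section Fact

variable {X1 X2 X3 U1 U2 V1 V2 : Type}
    [Fintype X1] [Fintype X2] [Fintype X3] [Fintype U1] [Fintype U2] [Fintype V1] [Fintype V2]

lemma dist_single {Ω α : Type*} [Fintype Ω] [Fintype α] (w : Ω → ℝ) (X : Ω → α) (x : α) (ω0 : Ω)
    (h : ∀ ω, X ω = x ↔ ω = ω0) : IT.dist w X x = w ω0 := by
  classical
  have : IT.dist w X x = IT.dist w id ω0 := dist_congr' w X id x ω0 h
  rw [this]
  unfold IT.dist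
  simp

/-- Combine a source letter and an auxiliary pair to a full letter. -/
def full (b : X1 × X2 × X3 × V1 × V2) (c : U1 × U2) : X1 × X2 × X3 × U1 × U2 × V1 × V2 :=
  (b.1, b.2.1, b.2.2.1, c.1, c.2, b.2.2.2.1, b.2.2.2.2)

/-- The source marginal. -/
def srcMarg (p : X1 × X2 × X3 × U1 × U2 × V1 × V2 → ℝ) (b : X1 × X2 × X3 × V1 × V2) : ℝ :=
  ∑ c : U1, ∑ d : U2, p (b.1, b.2.1, b.2.2.1, c, d, b.2.2.2.1, b.2.2.2.2)

/-- First encoding kernel. -/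
def kA (p : X1 × X2 × X3 × U1 × U2 × V1 × V2 → ℝ) : X1 × V1 → U1 → ℝ :=
  ck p (fun a => a.2.2.2.1) (fun a => (a.1, a.2.2.2.2.2.1))

/-- Second encoding kernel. -/
def kB (p : X1 × X2 × X3 × U1 × U2 × V1 × V2 → ℝ) : U1 × X2 × V1 → U2 → ℝ :=
  ck p (fun a => a.2.2.2.2.1) (fun a => (a.2.2.2.1, a.2.1, a.2.2.2.2.2.1))

/-- Joint encoding kernel. -/
def kJ (p : X1 × X2 × X3 × U1 × U2 × V1 × V2 → ℝ) (b : X1 × X2 × X3 × V1 × V2) (c : U1 × U2) : ℝ :=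
  kA p (b.1, b.2.2.2.1) c.1 * kB p (c.1, b.2.1, b.2.2.2.1) c.2

lemma sum_full (f : X1 × X2 × X3 × U1 × U2 × V1 × V2 → ℝ) :
    ∑ b : X1 × X2 × X3 × V1 × V2, ∑ c : U1 × U2, f (full b c) = ∑ ω, f ω := by
  rw [← Fintype.sum_prod_type' (fun b c => f (full b c))]
  refine Fintype.sum_equiv
    { toFun := fun bc => full bc.1 bc.2
      invFun := fun ω => ((ω.1, ω.2.1, ω.2.2.1, ω.2.2.2.2.2.1, ω.2.2.2.2.2.2),
        (ω.2.2.2.1, ω.2.2.2.2.1))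
      left_inv := fun _ => rfl
      right_inv := fun _ => rfl } _ _ fun _ => rfl

lemma srcMarg_eq (p : X1 × X2 × X3 × U1 × U2 × V1 × V2 → ℝ) (b : X1 × X2 × X3 × V1 × V2) :
    srcMarg p b = ∑ c, p (full b c) := by
  unfold srcMarg full
  rw [Fintype.sum_prod_type]

lemma srcMarg_pmf (p : X1 × X2 × X3 × U1 × U2 × V1 × V2 → ℝ) (hp : IsPMF p) :
    IsPMF (srcMarg p) := by
  refine ⟨fun b => ?_, ?_⟩
  · rw [srcMarg_eq]
    exact Finset.sum_nonneg fun c _ => hp.1 _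
  · simp_rw [srcMarg_eq]
    rw [sum_full p, hp.2]

lemma kJ_nonneg (p : X1 × X2 × X3 × U1 × U2 × V1 × V2 → ℝ) (hp : IsPMF p)
    (b : X1 × X2 × X3 × V1 × V2) (c : U1 × U2) : 0 ≤ kJ p b c :=
  mul_nonneg (ck_nonneg p hp.1 _ _ _ _) (ck_nonneg p hp.1 _ _ _ _)

lemma kJ_sum [Nonempty U1] [Nonempty U2] (p : X1 × X2 × X3 × U1 × U2 × V1 × V2 → ℝ)
    (b : X1 × X2 × X3 × V1 × V2) : ∑ c, kJ p b c = 1 := by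
  unfold kJ
  rw [Fintype.sum_prod_type]
  simp only
  simp_rw [← Finset.mul_sum, kB, ck_sum, mul_one]
  exact ck_sum _ _ _ _

lemma p_fact (p : X1 × X2 × X3 × U1 × U2 × V1 × V2 → ℝ) (hp : IsPMF p)
    (hmc1 : IT.condMutInfo p (fun a => a.2.2.2.1)
      (fun a => (a.2.1, a.2.2.1, a.2.2.2.2.2.2)) (fun a => (a.1, a.2.2.2.2.2.1)) = 0)
    (hmc2 : IT.condMutInfo p (fun a => a.2.2.2.2.1)
      (fun a => (a.1, a.2.2.1, a.2.2.2.2.2.2))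
      (fun a => (a.2.2.2.1, a.2.1, a.2.2.2.2.2.1)) = 0)
    (b : X1 × X2 × X3 × V1 × V2) (c : U1 × U2) :
    p (full b c) = srcMarg p b * kJ p b c := by
  obtain ⟨x1, x2, x3, v1, v2⟩ := b
  obtain ⟨u1, u2⟩ := c
  have e1 := ck_markov p hp _ _ _ hmc2 u2 (x1, x3, v2) (u1, x2, v1)
  have e2 := ck_markov p hp _ _ _ hmc1 u1 (x2, x3, v2) (x1, v1)
  have e0 := dist_single p
    (fun a => (a.2.2.2.2.1, (a.1, a.2.2.1, a.2.2.2.2.2.2), (a.2.2.2.1, a.2.1, a.2.2.2.2.2.1)))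
    (u2, (x1, x3, v2), (u1, x2, v1)) (x1, x2, x3, u1, u2, v1, v2)
    (fun a => by
      obtain ⟨a1, a2, a3, a4, a5, a6, a7⟩ := a
      simp only [Prod.mk.injEq]; tauto)
  have e3 := dist_congr' p
    (fun a => ((a.1, a.2.2.1, a.2.2.2.2.2.2), (a.2.2.2.1, a.2.1, a.2.2.2.2.2.1)))
    (fun a => (a.2.2.2.1, (a.2.1, a.2.2.1, a.2.2.2.2.2.2), (a.1, a.2.2.2.2.2.1)))
    ((x1, x3, v2), (u1, x2, v1)) (u1, (x2, x3, v2), (x1, v1))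
    (fun a => by simp only [Prod.mk.injEq]; tauto)
  have e4 := dist_marg p (fun a => (a.2.2.2.1, a.2.2.2.2.1))
    (fun a => ((a.2.1, a.2.2.1, a.2.2.2.2.2.2), (a.1, a.2.2.2.2.2.1))) ((x2, x3, v2), (x1, v1))
  have e5 : ∑ c : U1 × U2, IT.dist p (fun a => ((a.2.2.2.1, a.2.2.2.2.1),
      ((a.2.1, a.2.2.1, a.2.2.2.2.2.2), (a.1, a.2.2.2.2.2.1)))) (c, ((x2, x3, v2), (x1, v1)))
      = srcMarg p (x1, x2, x3, v1, v2) := by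
    rw [srcMarg_eq]
    refine Finset.sum_congr rfl fun c _ => ?_
    refine dist_single p _ _ _ fun a => ?_
    obtain ⟨a1, a2, a3, a4, a5, a6, a7⟩ := a
    obtain ⟨c1, c2⟩ := c
    simp only [Prod.mk.injEq, full]; tauto
  rw [e5] at e4
  rw [e0, e3, e2, ← e4] at e1
  show p (x1, x2, x3, u1, u2, v1, v2) = _
  rw [e1]
  simp only [kJ, kA, kB]
  ring

lemma mean_eq (p : X1 × X2 × X3 × U1 × U2 × V1 × V2 → ℝ) (hp : IsPMF p)
    (hmc1 : IT.condMutInfo p (fun a => a.2.2.2.1)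
      (fun a => (a.2.1, a.2.2.1, a.2.2.2.2.2.2)) (fun a => (a.1, a.2.2.2.2.2.1)) = 0)
    (hmc2 : IT.condMutInfo p (fun a => a.2.2.2.2.1)
      (fun a => (a.1, a.2.2.1, a.2.2.2.2.2.2))
      (fun a => (a.2.2.2.1, a.2.1, a.2.2.2.2.2.1)) = 0)
    (ψ : X1 × X2 × X3 × U1 × U2 × V1 × V2 → ℝ) :
    ∑ b, srcMarg p b * ∑ c, kJ p b c * ψ (full b c) = ∑ ω, p ω * ψ ω := by
  rw [← sum_full (fun ω => p ω * ψ ω)]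
  refine Finset.sum_congr rfl fun b _ => ?_
  rw [Finset.mul_sum]
  refine Finset.sum_congr rfl fun c _ => ?_
  rw [p_fact p hp hmc1 hmc2 b c]
  ring

end Fact

section Code

lemma sum_pair {n : ℕ} {A B : Type*} [Fintype A] [Fintype B]
    (f : (Fin n → A) → (Fin n → B) → ℝ) :
    ∑ a, ∑ b, f a b = ∑ c : Fin n → A × B, f (fun t => (c t).1) (fun t => (c t).2) := by
  rw [← Fintype.sum_prod_type' f]
  refine (Fintype.sum_equiv (Equiv.arrowProdEquivProdArrow (Fin n) (fun _ => A) (fun _ => B))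
    _ _ fun _ => rfl).symm

lemma ratio_le {C D x y z : ℝ} (hC : C ≤ (2 : ℝ) ^ x) (hD : (2 : ℝ) ^ y ≤ D) (h : x + z ≤ y) :
    C * (1 / D) ≤ (2 : ℝ) ^ (-z) := by
  have hD0 : 0 < D := lt_of_lt_of_le (by positivity) hD
  rw [mul_one_div, div_le_iff₀ hD0]
  calc C ≤ (2 : ℝ) ^ x := hC
    _ ≤ (2 : ℝ) ^ (-z + y) := Real.rpow_le_rpow_of_exponent_le (by norm_num) (by linarith)
    _ = (2 : ℝ) ^ (-z) * (2 : ℝ) ^ y := Real.rpow_add (by norm_num) _ _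
    _ ≤ _ := mul_le_mul_of_nonneg_left hD (by positivity)

lemma ind_mono {P Q : Prop} (h : P → Q) : ind P ≤ ind Q := by
  by_cases hP : P
  · rw [ind_true hP, ind_true (h hP)]
  · rw [ind_false hP]
    exact ind_nonneg _

variable {X1 X2 X3 U1 U2 V1 V2 : Type}
    [Fintype X1] [Fintype X2] [Fintype X3] [Fintype U1] [Fintype U2] [Fintype V1] [Fintype V2]

/-- Smoothed law of `U1` given `(X2,V1)`. -/
def q1 (δ : ℝ) (p : X1 × X2 × X3 × U1 × U2 × V1 × V2 → ℝ) : X2 × V1 → U1 → ℝ :=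
  sk δ p (fun a => a.2.2.2.1) (fun a => (a.2.1, a.2.2.2.2.2.1))

/-- Smoothed law of `U2` given `(X3,V1,V2,U1)`. -/
def q2 (δ : ℝ) (p : X1 × X2 × X3 × U1 × U2 × V1 × V2 → ℝ) : X3 × V1 × V2 × U1 → U2 → ℝ :=
  sk δ p (fun a => a.2.2.2.2.1)
    (fun a => (a.2.2.1, a.2.2.2.2.2.1, a.2.2.2.2.2.2, a.2.2.2.1))

/-- Smoothed law of `(U1,U2)` given `(X3,V1,V2)`. -/
def q3 (δ : ℝ) (p : X1 × X2 × X3 × U1 × U2 × V1 × V2 → ℝ) : X3 × V1 × V2 → U1 × U2 → ℝ :=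
  sk δ p (fun a => (a.2.2.2.1, a.2.2.2.2.1))
    (fun a => (a.2.2.1, a.2.2.2.2.2.1, a.2.2.2.2.2.2))

/-- The family of test functions. -/
def tst (δ : ℝ) (p : X1 × X2 × X3 × U1 × U2 × V1 × V2 → ℝ) :
    Fin 5 ⊕ (X1 × X2 × X3 × U1 × U2 × V1 × V2) → X1 × X2 × X3 × U1 × U2 × V1 × V2 → ℝ
  | Sum.inl 0 => fun a => -Real.logb 2 (kA p (a.1, a.2.2.2.2.2.1) a.2.2.2.1)
  | Sum.inl 1 => fun a => -Real.logb 2 (kB p (a.2.2.2.1, a.2.1, a.2.2.2.2.2.1) a.2.2.2.2.1)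
  | Sum.inl 2 => fun a => -Real.logb 2 (q1 δ p (a.2.1, a.2.2.2.2.2.1) a.2.2.2.1)
  | Sum.inl 3 => fun a => -Real.logb 2
      (q2 δ p (a.2.2.1, a.2.2.2.2.2.1, a.2.2.2.2.2.2, a.2.2.2.1) a.2.2.2.2.1)
  | Sum.inl 4 => fun a => -Real.logb 2
      (q3 δ p (a.2.2.1, a.2.2.2.2.2.1, a.2.2.2.2.2.2) (a.2.2.2.1, a.2.2.2.2.1))
  | Sum.inr a => fun ω => ind (ω = a)

/-- The empirical averages of all tests are within `τ` of their means. -/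
def AllGood (δ τ : ℝ) (p : X1 × X2 × X3 × U1 × U2 × V1 × V2 → ℝ) {n : ℕ}
    (s : Fin n → X1 × X2 × X3 × V1 × V2) (c : Fin n → U1 × U2) : Prop :=
  ∀ i, |∑ t, tst δ p i (full (s t) (c t)) - n * ∑ ω, p ω * tst δ p i ω| ≤ n * τ

lemma code_exists [Nonempty U1] [Nonempty U2]
    (p : X1 × X2 × X3 × U1 × U2 × V1 × V2 → ℝ) (hp : IsPMF p)
    (n : ℕ) {Ω : Type} [Fintype Ω] (w : Ω → ℝ) (hw : ∀ ω, 0 ≤ w ω)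
    (S1 : Ω → Fin n → X1) (S2 : Ω → Fin n → X2) (S3 : Ω → Fin n → X3)
    (SV1 : Ω → Fin n → V1) (SV2 : Ω → Fin n → V2)
    (δ τ R1 R2 : ℝ) (hδ : 0 < δ) (hτ : τ ≤ δ)
    (g1 : IT.condH p (fun a => a.2.2.2.1) (fun a => (a.2.1, a.2.2.2.2.2.1)) + 5 * δ
      ≤ R1 + IT.condH p (fun a => a.2.2.2.1) (fun a => (a.1, a.2.2.2.2.2.1)))
    (g2 : IT.condH p (fun a => a.2.2.2.2.1)
        (fun a => (a.2.2.1, a.2.2.2.2.2.1, a.2.2.2.2.2.2, a.2.2.2.1)) + 5 * δ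
      ≤ R2 + IT.condH p (fun a => a.2.2.2.2.1) (fun a => (a.2.2.2.1, a.2.1, a.2.2.2.2.2.1)))
    (g3 : IT.condH p (fun a => (a.2.2.2.1, a.2.2.2.2.1))
        (fun a => (a.2.2.1, a.2.2.2.2.2.1, a.2.2.2.2.2.2)) + 7 * δ
      ≤ R1 + R2 + IT.condH p (fun a => a.2.2.2.1) (fun a => (a.1, a.2.2.2.2.2.1))
        + IT.condH p (fun a => a.2.2.2.2.1) (fun a => (a.2.2.2.1, a.2.1, a.2.2.2.2.2.1)))
    (m1 m2 : ℕ) (hm1 : (2 : ℝ) ^ (n * R1) ≤ m1) (hm2 : (2 : ℝ) ^ (n * R2) ≤ m2) :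
    ∃ (f1 : (Fin n → X1) → (Fin n → V1) → Fin m1)
        (f2 : (Fin n → X2) → (Fin n → V1) → Fin m1 → Fin m2)
        (g : (Fin n → X3) → (Fin n → V1) → (Fin n → V2) → Fin m1 → Fin m2 →
          (Fin n → U1) × (Fin n → U2)),
      (1 - 11 * (2 : ℝ) ^ (-(n * δ))) * ∑ ω, w ω * ∑ c : Fin n → U1 × U2,
        (∏ t, kJ p (S1 ω t, S2 ω t, S3 ω t, SV1 ω t, SV2 ω t) (c t)) *
          ind (AllGood δ τ p (fun t => (S1 ω t, S2 ω t, S3 ω t, SV1 ω t, SV2 ω t)) c)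
      ≤ ∑ ω, w ω * ind (AllGood δ τ p (fun t => (S1 ω t, S2 ω t, S3 ω t, SV1 ω t, SV2 ω t))
          (fun t => ((g (S3 ω) (SV1 ω) (SV2 ω) (f1 (S1 ω) (SV1 ω))
                  (f2 (S2 ω) (SV1 ω) (f1 (S1 ω) (SV1 ω)))).1 t,
               (g (S3 ω) (SV1 ω) (SV2 ω) (f1 (S1 ω) (SV1 ω))
                  (f2 (S2 ω) (SV1 ω) (f1 (S1 ω) (SV1 ω)))).2 t))) := by
  classical
  set Hc1 := IT.condH p (fun a => a.2.2.2.1) (fun a => (a.1, a.2.2.2.2.2.1)) with hHc1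
  set Hc2 := IT.condH p (fun a => a.2.2.2.2.1)
    (fun a => (a.2.2.2.1, a.2.1, a.2.2.2.2.2.1)) with hHc2
  set h12 := IT.condH p (fun a => a.2.2.2.1) (fun a => (a.2.1, a.2.2.2.2.2.1)) with hh12
  set h2 := IT.condH p (fun a => a.2.2.2.2.1)
        (fun a => (a.2.2.1, a.2.2.2.2.2.1, a.2.2.2.2.2.2, a.2.2.2.1)) with hh2
  set h3 := IT.condH p (fun a => (a.2.2.2.1, a.2.2.2.2.1))
        (fun a => (a.2.2.1, a.2.2.2.2.2.1, a.2.2.2.2.2.2)) with hh3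
  have M0 : ∑ ω, p ω * tst δ p (Sum.inl 0) ω = Hc1 := ck_condH p hp.1 _ _
  have M1 : ∑ ω, p ω * tst δ p (Sum.inl 1) ω = Hc2 := ck_condH p hp.1 _ _
  have M2 : ∑ ω, p ω * tst δ p (Sum.inl 2) ω ≤ h12 + δ := sk_condH hδ p hp _ _
  have M3 : ∑ ω, p ω * tst δ p (Sum.inl 3) ω ≤ h2 + δ := sk_condH hδ p hp _ _
  have M4 : ∑ ω, p ω * tst δ p (Sum.inl 4) ω ≤ h3 + δ := sk_condH hδ p hp _ _
  have hn0 : (0 : ℝ) ≤ n := Nat.cast_nonneg n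
  have hnτ : n * τ ≤ n * δ := mul_le_mul_of_nonneg_left hτ hn0
  set k1 := ⌊(2 : ℝ) ^ (n * (Hc1 - 2 * δ))⌋₊ with hk1
  set k2 := ⌊(2 : ℝ) ^ (n * (Hc2 - 2 * δ))⌋₊ with hk2
  have k1le : (k1 : ℝ) ≤ (2 : ℝ) ^ (n * (Hc1 - 2 * δ)) := Nat.floor_le (by positivity)
  have k2le : (k2 : ℝ) ≤ (2 : ℝ) ^ (n * (Hc2 - 2 * δ)) := Nat.floor_le (by positivity)
  have k1ge : (2 : ℝ) ^ (n * (Hc1 - 2 * δ)) ≤ k1 + 1 := (Nat.lt_floor_add_one _).le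
  have k2ge : (2 : ℝ) ^ (n * (Hc2 - 2 * δ)) ≤ k2 + 1 := (Nat.lt_floor_add_one _).le
  have D1 : (2 : ℝ) ^ (n * R1 + n * (Hc1 - 2 * δ)) ≤ m1 * (k1 + 1) := by
    rw [Real.rpow_add (by norm_num)]
    exact mul_le_mul hm1 k1ge (by positivity) (by positivity)
  have D2 : (2 : ℝ) ^ (n * R2 + n * (Hc2 - 2 * δ)) ≤ m2 * (k2 + 1) := by
    rw [Real.rpow_add (by norm_num)]
    exact mul_le_mul hm2 k2ge (by positivity) (by positivity)
  have m1pos : 0 < m1 := by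
    have : (0 : ℝ) < m1 := lt_of_lt_of_le (by positivity) hm1
    exact_mod_cast this
  have m2pos : 0 < m2 := by
    have : (0 : ℝ) < m2 := lt_of_lt_of_le (by positivity) hm2
    exact_mod_cast this
  obtain ⟨f1, f2, g, hfg⟩ := oneshot w hw (fun ω => (S1 ω, SV1 ω)) (fun ω => (S2 ω, SV1 ω))
    (fun ω => (S3 ω, SV1 ω, SV2 ω)) m1 k1 m2 k2 m1pos m2pos
    (fun y (a : Fin n → U1) => ∏ t, kA p (y.1 t, y.2 t) (a t))
    (fun y a => Finset.prod_nonneg fun t _ => ck_nonneg p hp.1 _ _ _ _)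
    (fun y => by
      rw [sum_prod_pi (fun t x => kA p (y.1 t, y.2 t) x)]
      exact Finset.prod_eq_one fun t _ => ck_sum _ _ _ _)
    (fun y a (b : Fin n → U2) => ∏ t, kB p (a t, y.1 t, y.2 t) (b t))
    (fun y a b => Finset.prod_nonneg fun t _ => ck_nonneg p hp.1 _ _ _ _)
    (fun y a => by
      rw [sum_prod_pi (fun t x => kB p (a t, y.1 t, y.2 t) x)]
      exact Finset.prod_eq_one fun t _ => ck_sum _ _ _ _)
    (fun y a => ∑ t, -Real.logb 2 (q1 δ p (y.1 t, y.2 t) (a t)) ≤ n * (h12 + 2 * δ))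
    (fun y a b => ∑ t, -Real.logb 2 (q2 δ p (y.1 t, y.2.1 t, y.2.2 t, a t) (b t))
        ≤ n * (h2 + 2 * δ) ∧
      ∑ t, -Real.logb 2 (q3 δ p (y.1 t, y.2.1 t, y.2.2 t) (a t, b t)) ≤ n * (h3 + 2 * δ))
    (fun ω a b => AllGood δ τ p (fun t => (S1 ω t, S2 ω t, S3 ω t, SV1 ω t, SV2 ω t))
      (fun t => (a t, b t)))
    (fun ω a b hg => by
      have t2 := (abs_le.1 (hg (Sum.inl 2))).2
      have t3 := (abs_le.1 (hg (Sum.inl 3))).2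
      have t4 := (abs_le.1 (hg (Sum.inl 4))).2
      have u2 := mul_le_mul_of_nonneg_left M2 hn0
      have u3 := mul_le_mul_of_nonneg_left M3 hn0
      have u4 := mul_le_mul_of_nonneg_left M4 hn0
      refine ⟨?_, ?_, ?_⟩
      · refine le_trans (b := n * τ + n * ∑ ω, p ω * tst δ p (Sum.inl 2) ω) ?_ (by linarith)
        exact sub_le_iff_le_add.1 t2
      · refine le_trans (b := n * τ + n * ∑ ω, p ω * tst δ p (Sum.inl 3) ω) ?_ (by linarith)
        exact sub_le_iff_le_add.1 t3
      · refine le_trans (b := n * τ + n * ∑ ω, p ω * tst δ p (Sum.inl 4) ω) ?_ (by linarith)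
        exact sub_le_iff_le_add.1 t4)
    ((2 : ℝ) ^ (-(n * δ)))
    (fun ω a b hg => by
      have t0 := (abs_le.1 (hg (Sum.inl 0))).1
      rw [M0] at t0
      have := prod_le_rpow (fun t => kA p (S1 ω t, SV1 ω t) (a t))
        (fun t => ck_nonneg p hp.1 _ _ _ _) (n * (Hc1 - δ)) (by
          refine le_trans (b := n * Hc1 - n * τ) (by linarith) ?_
          have t0' : n * Hc1 - n * τ ≤ ∑ t, tst δ p (Sum.inl 0) (full (S1 ω t, S2 ω t, S3 ω t, SV1 ω t, SV2 ω t) (a t, b t)) := by linarith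
          exact t0')
      refine (mul_le_mul k1le this (Finset.prod_nonneg fun t _ => ck_nonneg p hp.1 _ _ _ _)
        (by positivity)).trans (le_of_eq ?_)
      rw [← Real.rpow_add (by norm_num)]
      congr 1
      ring)
    (fun ω a b hg => by
      have t0 := (abs_le.1 (hg (Sum.inl 1))).1
      rw [M1] at t0
      have := prod_le_rpow (fun t => kB p (a t, S2 ω t, SV1 ω t) (b t))
        (fun t => ck_nonneg p hp.1 _ _ _ _) (n * (Hc2 - δ)) (by
          refine le_trans (b := n * Hc2 - n * τ) (by linarith) ?_
          have t0' : n * Hc2 - n * τ ≤ ∑ t, tst δ p (Sum.inl 1) (full (S1 ω t, S2 ω t, S3 ω t, SV1 ω t, SV2 ω t) (a t, b t)) := by linarith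
          exact t0')
      refine (mul_le_mul k2le this (Finset.prod_nonneg fun t _ => ck_nonneg p hp.1 _ _ _ _)
        (by positivity)).trans (le_of_eq ?_)
      rw [← Real.rpow_add (by norm_num)]
      congr 1
      ring)
    (fun y => by
      refine ratio_le (count_le (fun t x => q1 δ p (y.1 t, y.2 t) x)
        (fun t x => sk_pos hδ p hp.1 _ _ _ _) (fun t => sk_sum _ _ _ _ _) _) D1 ?_
      have := mul_le_mul_of_nonneg_left g1 hn0
      linarith)
    (fun y a => by
      refine ratio_le (le_trans (Finset.sum_le_sum fun b _ => ind_mono And.left)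
        (count_le (fun t x => q2 δ p (y.1 t, y.2.1 t, y.2.2 t, a t) x)
        (fun t x => sk_pos hδ p hp.1 _ _ _ _) (fun t => sk_sum _ _ _ _ _) _)) D2 ?_
      have := mul_le_mul_of_nonneg_left g2 hn0
      linarith)
    (fun y => by
      rw [one_div_mul_one_div]
      refine ratio_le (le_trans (Finset.sum_le_sum fun a _ => Finset.sum_le_sum fun b _ =>
        ind_mono And.right) (le_trans (le_of_eq (sum_pair _)) 
        (count_le (fun t x => q3 δ p (y.1 t, y.2.1 t, y.2.2 t) x)
        (fun t x => sk_pos hδ p hp.1 _ _ _ _) (fun t => sk_sum _ _ _ _ _) _)))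
        (y := (n * R1 + n * (Hc1 - 2 * δ)) + (n * R2 + n * (Hc2 - 2 * δ))) ?_ ?_
      · rw [Real.rpow_add (by norm_num)]
        exact mul_le_mul D1 D2 (by positivity) (by positivity)
      · have := mul_le_mul_of_nonneg_left g3 hn0
        linarith)
  refine ⟨fun x v => f1 (x, v), fun x v => f2 (x, v), fun x v v' => g (x, v, v'), ?_⟩
  refine le_trans (le_of_eq ?_) hfg
  congr 1
  refine Finset.sum_congr rfl fun ω _ => ?_
  congr 1
  rw [sum_pair]
  refine Finset.sum_congr rfl fun c _ => ?_
  rw [mul_comm]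
  congr 1
  rw [← Finset.prod_mul_distrib]
  rfl

end Code

section Fin

lemma rate_le {n : ℕ} (hn : 0 < n) {R ε : ℝ} (hR : 0 ≤ R) (hε : 1 / (n : ℝ) ≤ ε) :
    (1 / (n : ℝ)) * Real.logb 2 (⌈(2 : ℝ) ^ (n * R)⌉₊ : ℕ) ≤ R + ε := by
  have hn' : (0 : ℝ) < n := by exact_mod_cast hn
  have h1 : (1 : ℝ) ≤ (2 : ℝ) ^ (n * R) := Real.one_le_rpow (by norm_num) (by positivity)
  have h2 : ((⌈(2 : ℝ) ^ (n * R)⌉₊ : ℕ) : ℝ) < (2 : ℝ) ^ (n * R) + 1 :=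
    Nat.ceil_lt_add_one (by positivity)
  have h3 : (2 : ℝ) ^ (n * R + 1) = (2 : ℝ) ^ (n * R) * 2 := by
    rw [Real.rpow_add (by norm_num), Real.rpow_one]
  have h4 : (0 : ℝ) < (⌈(2 : ℝ) ^ (n * R)⌉₊ : ℕ) :=
    lt_of_lt_of_le (by positivity) (Nat.le_ceil _)
  have h5 : Real.logb 2 (⌈(2 : ℝ) ^ (n * R)⌉₊ : ℕ) ≤ n * R + 1 := by
    rw [Real.logb_le_iff_le_rpow (by norm_num) h4, h3]
    linarith
  calc (1 / (n : ℝ)) * Real.logb 2 (⌈(2 : ℝ) ^ (n * R)⌉₊ : ℕ) ≤ (1 / (n : ℝ)) * (n * R + 1) :=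
        mul_le_mul_of_nonneg_left h5 (by positivity)
    _ = R + 1 / n := by field_simp
    _ ≤ _ := by linarith

lemma Nocc_eq_ind {n : ℕ} {α : Type*} (a : α) (x : Fin n → α) :
    (Nocc a x : ℝ) = ∑ t, ind (x t = a) := by
  classical
  unfold Nocc ind
  rw [Finset.card_filter]
  push_cast
  refine Finset.sum_congr rfl fun t _ => ?_
  by_cases h : x t = a <;> simp [h]

lemma pr_eq_ind {Ω : Type*} [Fintype Ω] (w : Ω → ℝ) (E : Ω → Prop) :
    IT.pr w E = ∑ ω, w ω * ind (E ω) := by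
  unfold IT.pr
  refine Finset.sum_congr rfl fun ω _ => ?_
  by_cases h : E ω
  · rw [if_pos h, ind_true h, mul_one]
  · rw [if_neg h, ind_false h, mul_zero]

variable {X1 X2 X3 U1 U2 V1 V2 : Type}
    [Fintype X1] [Fintype X2] [Fintype X3] [Fintype U1] [Fintype U2] [Fintype V1] [Fintype V2]

lemma allGood_typ (p : X1 × X2 × X3 × U1 × U2 × V1 × V2 → ℝ) {n : ℕ} (hn : 0 < n) (δ τ ε : ℝ)
    (hτ : τ ≤ ε / Fintype.card (U1 × U2 × V1 × V2 × X1 × X2 × X3))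
    (s1 : Fin n → X1) (s2 : Fin n → X2) (s3 : Fin n → X3) (v1 : Fin n → V1) (v2 : Fin n → V2)
    (a : Fin n → U1) (b : Fin n → U2)
    (h : AllGood δ τ p (fun t => (s1 t, s2 t, s3 t, v1 t, v2 t)) (fun t => (a t, b t))) :
    (fun t => (a t, b t, v1 t, v2 t, s1 t, s2 t, s3 t)) ∈
      typical (fun b : U1 × U2 × V1 × V2 × X1 × X2 × X3 =>
              p (b.2.2.2.2.1, b.2.2.2.2.2.1, b.2.2.2.2.2.2,
                 b.1, b.2.1, b.2.2.1, b.2.2.2.1)) ε n := by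
  classical
  rintro ⟨y1, y2, y3, y4, y5, y6, y7⟩ -
  refine le_trans ?_ hτ
  have hn' : (0 : ℝ) < n := by exact_mod_cast hn
  have h1 := h (Sum.inr (y5, y6, y7, y1, y2, y3, y4))
  have h2 : ∑ ω, p ω * tst δ p (Sum.inr (y5, y6, y7, y1, y2, y3, y4)) ω
      = p (y5, y6, y7, y1, y2, y3, y4) := by
    rw [Finset.sum_eq_single (y5, y6, y7, y1, y2, y3, y4)]
    · simp only [tst, ind_true, mul_one]
    · intro ω _ hω
      simp only [tst]
      rw [ind_false hω, mul_zero]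
    · intro hω
      exact absurd (Finset.mem_univ _) hω
  have h3 : (Nocc (y1, y2, y3, y4, y5, y6, y7)
      (fun t => (a t, b t, v1 t, v2 t, s1 t, s2 t, s3 t)) : ℝ)
      = ∑ t, tst δ p (Sum.inr (y5, y6, y7, y1, y2, y3, y4))
        (full (s1 t, s2 t, s3 t, v1 t, v2 t) (a t, b t)) := by
    rw [Nocc_eq_ind]
    refine Finset.sum_congr rfl fun t _ => ?_
    simp only [tst, full]
    congr 1
    simp only [Prod.mk.injEq, eq_iff_iff]
    tauto
  rw [h2] at h1
  simp only at h1 ⊢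
  rw [← h3] at h1
  have h4 : ∀ N P : ℝ, N / n - P = (N - n * P) / n := fun N P => by field_simp
  rw [h4, abs_div, abs_of_pos hn', div_le_iff₀ hn']
  linarith

end Fin

/-- **Inner bound for the cooperative Berger–Tung problem with side information.**
Under the two Markov conditions on the single-letter pmf `p`, if the rate pair strictly
dominates the stated mutual informations, then for every `ε > 0` there is a cooperative
Berger–Tung code whose output is jointly strongly typical with the sources and the side
informations except with probability at most `ε`. -/
theorem cooperative_berger_tung_inner_bound
    {X1 X2 X3 U1 U2 V1 V2 : Type}
    [Fintype X1] [Fintype X2] [Fintype X3] [Fintype U1] [Fintype U2] [Fintype V1] [Fintype V2]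
    [Nonempty U1] [Nonempty U2]
    (p : X1 × X2 × X3 × U1 × U2 × V1 × V2 → ℝ) (hp : IsPMF p)
    -- Markov chain U1 -∘- (X1,V1) -∘- (X2,X3,V2)
    (hmc1 : IT.condMutInfo p (fun a => a.2.2.2.1)
      (fun a => (a.2.1, a.2.2.1, a.2.2.2.2.2.2)) (fun a => (a.1, a.2.2.2.2.2.1)) = 0)
    -- Markov chain U2 -∘- (U1,X2,V1) -∘- (X1,X3,V2)
    (hmc2 : IT.condMutInfo p (fun a => a.2.2.2.2.1)
      (fun a => (a.1, a.2.2.1, a.2.2.2.2.2.2))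
      (fun a => (a.2.2.2.1, a.2.1, a.2.2.2.2.2.1)) = 0)
    -- the (arbitrarily distributed) source sequences
    (ΩS : ℕ → Type) [∀ n, Fintype (ΩS n)]
    (ws : (n : ℕ) → ΩS n → ℝ) (hws : ∀ n, IsPMF (ws n))
    (S1 : (n : ℕ) → ΩS n → Fin n → X1) (S2 : (n : ℕ) → ΩS n → Fin n → X2)
    (S3 : (n : ℕ) → ΩS n → Fin n → X3)
    (SV1 : (n : ℕ) → ΩS n → Fin n → V1) (SV2 : (n : ℕ) → ΩS n → Fin n → V2)
    -- the sources are asymptotically jointly typical w.r.t. the (X1,X2,X3,V1,V2)-marginal of p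
    (htyp : ∀ δ > (0 : ℝ), Filter.Tendsto (fun n => IT.pr (ws n) (fun ω =>
        (fun t => (S1 n ω t, S2 n ω t, S3 n ω t, SV1 n ω t, SV2 n ω t)) ∈
          typical (fun b : X1 × X2 × X3 × V1 × V2 =>
            ∑ c : U1, ∑ d : U2, p (b.1, b.2.1, b.2.2.1, c, d, b.2.2.2.1, b.2.2.2.2)) δ n))
      Filter.atTop (nhds 1))
    (R1 R2 : ℝ)
    -- rate conditions
    (hR1 : IT.condMutInfo p (fun a => a.1) (fun a => a.2.2.2.1)
      (fun a => (a.2.1, a.2.2.2.2.2.1)) < R1)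
    (hR2 : IT.condMutInfo p (fun a => a.2.1) (fun a => a.2.2.2.2.1)
      (fun a => (a.2.2.1, a.2.2.2.2.2.1, a.2.2.2.2.2.2, a.2.2.2.1)) < R2)
    (hR12 : IT.condMutInfo p (fun a => (a.1, a.2.1)) (fun a => (a.2.2.2.1, a.2.2.2.2.1))
      (fun a => (a.2.2.1, a.2.2.2.2.2.1, a.2.2.2.2.2.2)) < R1 + R2) :
    ∀ ε > (0 : ℝ), ∃ n : ℕ, 0 < n ∧ ∃ m1 m2 : ℕ, 0 < m1 ∧ 0 < m2 ∧
      ∃ (f1 : (Fin n → X1) → (Fin n → V1) → Fin m1)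
        (f2 : (Fin n → X2) → (Fin n → V1) → Fin m1 → Fin m2)
        (g : (Fin n → X3) → (Fin n → V1) → (Fin n → V2) → Fin m1 → Fin m2 →
          (Fin n → U1) × (Fin n → U2)),
        (1 / (n : ℝ)) * Real.logb 2 m1 ≤ R1 + ε ∧
        (1 / (n : ℝ)) * Real.logb 2 m2 ≤ R2 + ε ∧
        IT.pr (ws n) (fun ω =>
          ¬ ((fun t =>
              ((g (S3 n ω) (SV1 n ω) (SV2 n ω) (f1 (S1 n ω) (SV1 n ω))
                  (f2 (S2 n ω) (SV1 n ω) (f1 (S1 n ω) (SV1 n ω)))).1 t,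
               (g (S3 n ω) (SV1 n ω) (SV2 n ω) (f1 (S1 n ω) (SV1 n ω))
                  (f2 (S2 n ω) (SV1 n ω) (f1 (S1 n ω) (SV1 n ω)))).2 t,
               SV1 n ω t, SV2 n ω t, S1 n ω t, S2 n ω t, S3 n ω t)) ∈
            typical (fun b : U1 × U2 × V1 × V2 × X1 × X2 × X3 =>
              p (b.2.2.2.2.1, b.2.2.2.2.2.1, b.2.2.2.2.2.2,
                 b.1, b.2.1, b.2.2.1, b.2.2.2.1)) ε n)) ≤ ε := by
  intro ε hε
  have hI1 := condMutInfo_nonneg p hp (fun a => a.1) (fun a => a.2.2.2.1)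
      (fun a => (a.2.1, a.2.2.2.2.2.1))
  have hI2 := condMutInfo_nonneg p hp (fun a => a.2.1) (fun a => a.2.2.2.2.1)
      (fun a => (a.2.2.1, a.2.2.2.2.2.1, a.2.2.2.2.2.2, a.2.2.2.1))
  have ea := ent_a p hp (fun a => a.1) (fun a => a.2.1) (fun a => a.2.2.2.1)
    (fun a => a.2.2.2.2.2.1)
  have eb := ent_b p hp (fun a => a.2.1) (fun a => a.2.2.1) (fun a => a.2.2.2.1)
    (fun a => a.2.2.2.2.1) (fun a => a.2.2.2.2.2.1) (fun a => a.2.2.2.2.2.2)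
  have ec := ent_c p (fun a => a.1) (fun a => a.2.1) (fun a => a.2.2.1) (fun a => a.2.2.2.1)
    (fun a => a.2.2.2.2.1) (fun a => a.2.2.2.2.2.1) (fun a => a.2.2.2.2.2.2) hmc1 hmc2
  have hne : Nonempty (X1 × X2 × X3 × U1 × U2 × V1 × V2) := by
    by_contra h
    rw [not_nonempty_iff] at h
    have := hp.2
    simp at this
  have hne' : Nonempty (U1 × U2 × V1 × V2 × X1 × X2 × X3) := by
    obtain ⟨a⟩ := hne
    exact ⟨(a.2.2.2.1, a.2.2.2.2.1, a.2.2.2.2.2.1, a.2.2.2.2.2.2, a.1, a.2.1, a.2.2.1)⟩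
  -- the rate slack
  obtain ⟨δ, hδ, hδ1, hδ2, hδ3⟩ : ∃ δ > (0 : ℝ),
      5 * δ ≤ R1 - IT.condMutInfo p (fun a => a.1) (fun a => a.2.2.2.1)
        (fun a => (a.2.1, a.2.2.2.2.2.1)) ∧
      5 * δ ≤ R2 - IT.condMutInfo p (fun a => a.2.1) (fun a => a.2.2.2.2.1)
        (fun a => (a.2.2.1, a.2.2.2.2.2.1, a.2.2.2.2.2.2, a.2.2.2.1)) ∧
      7 * δ ≤ R1 + R2 - IT.condMutInfo p (fun a => (a.1, a.2.1))
        (fun a => (a.2.2.2.1, a.2.2.2.2.1))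
        (fun a => (a.2.2.1, a.2.2.2.2.2.1, a.2.2.2.2.2.2)) := by
    have key : ∀ x y z : ℝ, 0 < x → 0 < y → 0 < z →
        ∃ δ > (0 : ℝ), 5 * δ ≤ x ∧ 5 * δ ≤ y ∧ 7 * δ ≤ z := by
      intro x y z hx hy hz
      refine ⟨min x (min y z) / 7, by positivity, ?_, ?_, ?_⟩
      · have := min_le_left x (min y z); linarith
      · have := (min_le_right x (min y z)).trans (min_le_left y z); linarith
      · have := (min_le_right x (min y z)).trans (min_le_right y z); linarith
    exact key _ _ _ (by linarith) (by linarith) (by linarith)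
  -- the error slack
  set e : ℝ := min ε 1 with he
  have he0 : 0 < e := lt_min hε one_pos
  have he1 : e ≤ 1 := min_le_right _ _
  have heε : e ≤ ε := min_le_left _ _
  set L : ℝ := (Fintype.card (Fin 5 ⊕ (X1 × X2 × X3 × U1 × U2 × V1 × V2)) : ℝ) with hL
  have hL0 : 0 < L := by
    rw [hL]
    exact_mod_cast Fintype.card_pos
  have hK0 : (0 : ℝ) < Fintype.card (U1 × U2 × V1 × V2 × X1 × X2 × X3) := by
    exact_mod_cast Fintype.card_pos
  obtain ⟨τ, hτ, hτδ, hτL, hτK⟩ : ∃ τ > (0 : ℝ), τ ≤ δ ∧ τ ≤ e / (4 * L) ∧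
      τ ≤ ε / Fintype.card (U1 × U2 × V1 × V2 × X1 × X2 × X3) :=
    ⟨min δ (min (e / (4 * L)) (ε / Fintype.card (U1 × U2 × V1 × V2 × X1 × X2 × X3))),
      lt_min hδ (lt_min (by positivity) (by positivity)), min_le_left _ _,
      (min_le_right _ _).trans (min_le_left _ _), (min_le_right _ _).trans (min_le_right _ _)⟩
  have hLτ : L * τ ≤ e / 4 := by
    rw [le_div_iff₀ (by positivity)] at hτL
    linarith
  obtain ⟨δ0, hδ0, N, hN⟩ := multi_conc (srcMarg p) (srcMarg_pmf p hp) (kJ p) (kJ_nonneg p hp)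
    (kJ_sum p) (fun i b c => tst δ p i (full b c)) τ hτ
  -- the block length
  have c1 := (htyp δ0 hδ0).eventually (lt_mem_nhds (show 1 - e / 4 < (1 : ℝ) by linarith))
  have c2 : ∀ᶠ n : ℕ in Filter.atTop, 11 * (2 : ℝ) ^ (-((n : ℝ) * δ)) < e / 4 := by
    have hr : (2 : ℝ) ^ (-δ) < 1 := two_rpow_neg_lt hδ
    have ht := (tendsto_pow_atTop_nhds_zero_of_lt_one
      (show (0 : ℝ) ≤ (2 : ℝ) ^ (-δ) by positivity) hr).const_mul 11
    rw [mul_zero] at ht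
    filter_upwards [ht.eventually (gt_mem_nhds (show (0 : ℝ) < e / 4 by positivity))] with n hn
    have : (2 : ℝ) ^ (-((n : ℝ) * δ)) = ((2 : ℝ) ^ (-δ)) ^ n := by
      rw [← Real.rpow_natCast, ← Real.rpow_mul (by norm_num)]
      congr 1
      ring
    rw [this]
    exact hn
  have c3 : ∀ᶠ n : ℕ in Filter.atTop, 1 / (n : ℝ) < ε :=
    tendsto_one_div_atTop_nhds_zero_nat.eventually (gt_mem_nhds hε)
  obtain ⟨n, ⟨⟨hn1, hn2⟩, hn3⟩, hnN, hn0⟩ :=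
    (((c1.and c2).and c3).and
      ((Filter.eventually_ge_atTop N).and (Filter.eventually_gt_atTop 0))).exists
  refine ⟨n, hn0, ⌈(2 : ℝ) ^ (n * R1)⌉₊, ⌈(2 : ℝ) ^ (n * R2)⌉₊,
    Nat.ceil_pos.2 (by positivity), Nat.ceil_pos.2 (by positivity), ?_⟩
  obtain ⟨f1, f2, g, hfg⟩ := code_exists p hp n (ws n) (hws n).1 (S1 n) (S2 n) (S3 n) (SV1 n)
    (SV2 n) δ τ R1 R2 hδ hτδ (by linarith) (by linarith) (by linarith) _ _
    (Nat.le_ceil _) (Nat.le_ceil _)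
  refine ⟨f1, f2, g, rate_le hn0 (by linarith) hn3.le, rate_le hn0 (by linarith) hn3.le, ?_⟩
  -- the random-coding average
  have hin : (1 - e / 4) * (1 - e / 4) ≤ ∑ ω, ws n ω * ∑ c : Fin n → U1 × U2,
        (∏ t, kJ p (S1 n ω t, S2 n ω t, S3 n ω t, SV1 n ω t, SV2 n ω t) (c t)) *
          ind (AllGood δ τ p
            (fun t => (S1 n ω t, S2 n ω t, S3 n ω t, SV1 n ω t, SV2 n ω t)) c) := by
    rw [pr_eq_ind] at hn1
    refine (mul_le_mul_of_nonneg_left hn1.le (by linarith)).trans ?_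
    rw [Finset.mul_sum]
    refine Finset.sum_le_sum fun ω _ => ?_
    rw [mul_left_comm]
    refine mul_le_mul_of_nonneg_left ?_ ((hws n).1 ω)
    change (1 - e / 4) * ind (_ ∈ typical (srcMarg p) δ0 n) ≤ _
    by_cases hb : (fun t => (S1 n ω t, S2 n ω t, S3 n ω t, SV1 n ω t, SV2 n ω t)) ∈
        typical (srcMarg p) δ0 n
    · have := hN n hnN _ hb
      simp only [mean_eq p hp hmc1 hmc2] at this
      rw [ind_true hb, mul_one]
      refine le_trans ?_ this
      linarith
    · rw [ind_false hb, mul_zero]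
      exact Finset.sum_nonneg fun c _ => mul_nonneg
        (Finset.prod_nonneg fun t _ => kJ_nonneg p hp _ _) (ind_nonneg _)
  have hfin : 1 - e ≤ _ := le_trans (by
    have h1 : (1 - e / 4) * ((1 - e / 4) * (1 - e / 4)) ≤ _ :=
      mul_le_mul (show 1 - e / 4 ≤ 1 - 11 * (2 : ℝ) ^ (-((n : ℝ) * δ)) by linarith) hin
        (by nlinarith) (by linarith)
    refine le_trans ?_ h1
    nlinarith [mul_pos he0 he0]) hfg
  rw [pr_eq_ind]
  refine le_trans (b := 1 - (1 - e)) ?_ (by linarith)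
  refine le_trans ?_ (sub_le_sub_left hfin 1)
  rw [← (hws n).2, ← Finset.sum_sub_distrib]
  refine Finset.sum_le_sum fun ω _ => ?_
  rw [show ∀ x y : ℝ, x - x * y = x * (1 - y) from fun x y => by ring]
  refine mul_le_mul_of_nonneg_left ?_ ((hws n).1 ω)
  by_cases hg : AllGood δ τ p (fun t => (S1 n ω t, S2 n ω t, S3 n ω t, SV1 n ω t, SV2 n ω t))
          (fun t => ((g (S3 n ω) (SV1 n ω) (SV2 n ω) (f1 (S1 n ω) (SV1 n ω))
                  (f2 (S2 n ω) (SV1 n ω) (f1 (S1 n ω) (SV1 n ω)))).1 t,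
               (g (S3 n ω) (SV1 n ω) (SV2 n ω) (f1 (S1 n ω) (SV1 n ω))
                  (f2 (S2 n ω) (SV1 n ω) (f1 (S1 n ω) (SV1 n ω)))).2 t))
  · rw [ind_false (not_not.2 (allGood_typ p hn0 δ τ ε hτK _ _ _ _ _ _ _ hg)), ind_true hg]
    linarith
  · rw [ind_false hg]
    have := ind_le_one (¬ ((fun t =>
              ((g (S3 n ω) (SV1 n ω) (SV2 n ω) (f1 (S1 n ω) (SV1 n ω))
                  (f2 (S2 n ω) (SV1 n ω) (f1 (S1 n ω) (SV1 n ω)))).1 t,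
               (g (S3 n ω) (SV1 n ω) (SV2 n ω) (f1 (S1 n ω) (SV1 n ω))
                  (f2 (S2 n ω) (SV1 n ω) (f1 (S1 n ω) (SV1 n ω)))).2 t,
               SV1 n ω t, SV2 n ω t, S1 n ω t, S2 n ω t, S3 n ω t)) ∈
            typical (fun b : U1 × U2 × V1 × V2 × X1 × X2 × X3 =>
              p (b.2.2.2.2.1, b.2.2.2.2.2.1, b.2.2.2.2.2.2,
                 b.1, b.2.1, b.2.2.1, b.2.2.2.1)) ε n))
    linarith
end
end

section
/- (Markov chains induced by interactive encoding of three nodes, items 4 and 5.) For every t ∈ {1,…,n}: (4) Z_{[t+1:n]} −∘− (J_x^{[1:K]}, J_y^{[1:K]}, J_z^{[1:K]}, X^n, Y_{[t+1:n]}, Z_{[1:t]}) −∘− Y_t; and (5) Y_{[1:t-1]} −∘− (J_x^{[1:K]}, J_y^{[1:K]}, J_z^{[1:K]}, X^n, Y_{[t:n]}, Z_{[1:t-1]}) −∘− Z_t. -/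
noncomputable section

open IT

namespace IT

theorem H_eq {Ω α : Type*} [Fintype Ω] [Fintype α] (w : Ω → ℝ) (X : Ω → α) :
    H w X = -∑ ω, w ω * Real.logb 2 (dist w X (X ω)) := by
  classical
  unfold H
  congr 1
  have h : ∀ a, dist w X a * Real.logb 2 (dist w X a)
      = ∑ ω, if X ω = a then w ω * Real.logb 2 (dist w X (X ω)) else 0 := by
    intro a
    conv_lhs => rw [dist, Finset.sum_mul]
    refine Finset.sum_congr rfl fun ω _ => ?_
    by_cases hh : X ω = a
    · subst hh
      simp [dist]
    · simp [hh]
  rw [Finset.sum_congr rfl fun a _ => h a, Finset.sum_comm]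
  simp

theorem dist_pos {Ω α : Type*} [Fintype Ω] [Fintype α] (w : Ω → ℝ) (hw : ∀ ω, 0 ≤ w ω)
    (X : Ω → α) (ω : Ω) (h : 0 < w ω) : 0 < dist w X (X ω) := by
  classical
  unfold dist
  refine Finset.sum_pos' (fun i _ => ?_) ⟨ω, Finset.mem_univ _, by simpa using h⟩
  split_ifs
  · exact hw i
  · exact le_rfl

theorem condMutInfo_zero {Ω α β γ : Type*} [Fintype Ω] [Fintype α] [Fintype β] [Fintype γ]
    (w : Ω → ℝ) (hw : ∀ ω, 0 ≤ w ω) (X : Ω → α) (Y : Ω → β) (Z : Ω → γ)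
    (h : ∀ a b c, dist w (fun ω => (X ω, (Y ω, Z ω))) (a, (b, c)) * dist w Z c
      = dist w (fun ω => (X ω, Z ω)) (a, c) * dist w (fun ω => (Y ω, Z ω)) (b, c)) :
    condMutInfo w X Y Z = 0 := by
  unfold condMutInfo condH
  simp only [H_eq]
  have key : ∑ ω, w ω * Real.logb 2 (dist w (fun ω => (X ω, (Y ω, Z ω))) (X ω, (Y ω, Z ω)))
      + ∑ ω, w ω * Real.logb 2 (dist w Z (Z ω))
      = ∑ ω, w ω * Real.logb 2 (dist w (fun ω => (X ω, Z ω)) (X ω, Z ω))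
      + ∑ ω, w ω * Real.logb 2 (dist w (fun ω => (Y ω, Z ω)) (Y ω, Z ω)) := by
    rw [← Finset.sum_add_distrib, ← Finset.sum_add_distrib]
    refine Finset.sum_congr rfl fun ω _ => ?_
    rcases (hw ω).eq_or_lt with h0 | h0
    · simp [← h0]
    · rw [← mul_add, ← mul_add, ← Real.logb_mul, ← Real.logb_mul, h]
      · exact (dist_pos w hw (fun ω => (X ω, Z ω)) ω h0).ne'
      · exact (dist_pos w hw (fun ω => (Y ω, Z ω)) ω h0).ne'
      · exact (dist_pos w hw (fun ω => (X ω, (Y ω, Z ω))) ω h0).ne'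
      · exact (dist_pos w hw Z ω h0).ne'
  linarith

theorem condMutInfo_zero_of_swap {Ω α β γ : Type*} [Fintype Ω] [Fintype α] [Fintype β] [Fintype γ]
    (w : Ω → ℝ) (hw : ∀ ω, 0 ≤ w ω) (X : Ω → α) (Y : Ω → β) (Z : Ω → γ)
    (m : Ω → Ω → Ω) (hm : ∀ u v, m (m u v) (m v u) = u)
    (hmw : ∀ u v, w (m u v) * w (m v u) = w u * w v)
    (hZ : ∀ u v, Z u = Z v → Z (m u v) = Z u)
    (hX : ∀ u v, Z u = Z v → X (m u v) = X u)
    (hY : ∀ u v, Z u = Z v → Y (m u v) = Y v) :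
    condMutInfo w X Y Z = 0 := by
  classical
  refine condMutInfo_zero w hw X Y Z fun a b c => ?_
  unfold dist
  rw [Finset.sum_mul_sum, Finset.sum_mul_sum, ← Finset.sum_product', ← Finset.sum_product']
  let e : Ω × Ω → Ω × Ω := fun q => (m q.1 q.2, m q.2 q.1)
  have he : Function.Involutive e := fun q => by simp [e, hm]
  refine Fintype.sum_bijective e he.bijective _ _ ?_
  rintro ⟨u, v⟩
  have h1 : ((X u, Y u, Z u) = (a, b, c) ∧ Z v = c) ↔
      ((X (m u v), Z (m u v)) = (a, c) ∧ (Y (m v u), Z (m v u)) = (b, c)) := by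
    simp only [Prod.mk.injEq]
    constructor
    · rintro ⟨⟨hx, hy, hz⟩, hv⟩
      have huv : Z u = Z v := hz.trans hv.symm
      exact ⟨⟨(hX _ _ huv).trans hx, (hZ _ _ huv).trans hz⟩,
        (hY _ _ huv.symm).trans hy, (hZ _ _ huv.symm).trans hv⟩
    · rintro ⟨⟨hx, hz⟩, hy, hv⟩
      have huv : Z (m u v) = Z (m v u) := hz.trans hv.symm
      have e1 := hX _ _ huv
      have e2 := hY _ _ huv
      have e3 := hZ _ _ huv
      have e4 := hZ _ _ huv.symm
      rw [hm] at e1 e2 e3 e4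
      exact ⟨⟨e1.trans hx, e2.trans hy, e3.trans hz⟩, e4.trans hv⟩
  have h2 : ∀ (P Q : Prop) [Decidable P] [Decidable Q] (r s : ℝ), (if P then r else 0) * (if Q then s else 0)
      = if P ∧ Q then r * s else 0 := by
    intro P Q _ _ r s
    by_cases P <;> by_cases Q <;> simp [*]
  simp only [e, h2, hmw]
  exact if_congr h1 rfl rfl

end IT

/-- Replace the coordinates in `S` of `u` by those of `v`. -/
def mixCoord {n : ℕ} {α : Type*} (S : Fin n → Prop) [DecidablePred S] (u v : Fin n → α) :
    Fin n → α := fun s => if S s then v s else u s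

theorem mixCoord_mixCoord {n : ℕ} {α : Type*} (S : Fin n → Prop) [DecidablePred S]
    (u v : Fin n → α) : mixCoord S (mixCoord S u v) (mixCoord S v u) = u := by
  funext s
  by_cases h : S s <;> simp [mixCoord, h]

theorem iidW_mixCoord {n : ℕ} {α : Type*} (p : α → ℝ) (S : Fin n → Prop) [DecidablePred S]
    (u v : Fin n → α) :
    iidW p n (mixCoord S u v) * iidW p n (mixCoord S v u) = iidW p n u * iidW p n v := by
  unfold iidW
  rw [← Finset.prod_mul_distrib, ← Finset.prod_mul_distrib]
  refine Finset.prod_congr rfl fun s _ => ?_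
  by_cases h : S s <;> simp [mixCoord, h, mul_comm]

/-- **Lemma (interactive encoding of three nodes), items 4 and 5.** -/
theorem three_node_interactive_markov_items4_5
    {XA YA ZA : Type} [Fintype XA] [Fintype YA] [Fintype ZA]
    (p : XA × YA × ZA → ℝ) (hp : IsPMF p)
    {n K : ℕ} (mx my mz : Fin K → ℕ)
    (Jx : (l : Fin K) → (Fin n → XA × YA × ZA) → Fin (mx l))
    (Jy : (l : Fin K) → (Fin n → XA × YA × ZA) → Fin (my l))
    (Jz : (l : Fin K) → (Fin n → XA × YA × ZA) → Fin (mz l))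
    -- J_x^l = f_x^l(Xⁿ, J_x^{[1:l-1]}, J_y^{[1:l-1]}, J_z^{[1:l-1]})
    (hJx : ∀ l : Fin K, ∃ f : (Fin n → XA) →
        ((k : Fin K) → k.val < l.val → Fin (mx k)) →
        ((k : Fin K) → k.val < l.val → Fin (my k)) →
        ((k : Fin K) → k.val < l.val → Fin (mz k)) → Fin (mx l),
      ∀ ω, Jx l ω = f (fun t => (ω t).1)
        (fun k _ => Jx k ω) (fun k _ => Jy k ω) (fun k _ => Jz k ω))
    -- J_y^l = f_y^l(Yⁿ, J_x^{[1:l]}, J_y^{[1:l-1]}, J_z^{[1:l-1]})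
    (hJy : ∀ l : Fin K, ∃ f : (Fin n → YA) →
        ((k : Fin K) → k.val ≤ l.val → Fin (mx k)) →
        ((k : Fin K) → k.val < l.val → Fin (my k)) →
        ((k : Fin K) → k.val < l.val → Fin (mz k)) → Fin (my l),
      ∀ ω, Jy l ω = f (fun t => (ω t).2.1)
        (fun k _ => Jx k ω) (fun k _ => Jy k ω) (fun k _ => Jz k ω))
    -- J_z^l = f_z^l(Zⁿ, J_x^{[1:l]}, J_y^{[1:l]}, J_z^{[1:l-1]})
    (hJz : ∀ l : Fin K, ∃ f : (Fin n → ZA) →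
        ((k : Fin K) → k.val ≤ l.val → Fin (mx k)) →
        ((k : Fin K) → k.val ≤ l.val → Fin (my k)) →
        ((k : Fin K) → k.val < l.val → Fin (mz k)) → Fin (mz l),
      ∀ ω, Jz l ω = f (fun t => (ω t).2.2)
        (fun k _ => Jx k ω) (fun k _ => Jy k ω) (fun k _ => Jz k ω))
    :
    ∀ t : Fin n,
      -- (4) Z_{[t+1:n]} -∘- (J_x^{[1:K]}, J_y^{[1:K]}, J_z^{[1:K]}, Xⁿ, Y_{[t+1:n]}, Z_{[1:t]}) -∘- Y_t
      IT.condMutInfo (iidW p n)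
        (fun ω => above t.val (fun s => (ω s).2.2))
        (fun ω => (ω t).2.1)
        (fun ω => ((fun k => Jx k ω), (fun k => Jy k ω), (fun k => Jz k ω),
          (fun s => (ω s).1), above t.val (fun s => (ω s).2.1),
          below (t.val + 1) (fun s => (ω s).2.2))) = 0 ∧
      -- (5) Y_{[1:t-1]} -∘- (J_x^{[1:K]}, J_y^{[1:K]}, J_z^{[1:K]}, Xⁿ, Y_{[t:n]}, Z_{[1:t-1]}) -∘- Z_t
      IT.condMutInfo (iidW p n)
        (fun ω => below t.val (fun s => (ω s).2.1))
        (fun ω => (ω t).2.2)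
        (fun ω => ((fun k => Jx k ω), (fun k => Jy k ω), (fun k => Jz k ω),
          (fun s => (ω s).1), fromIdx t.val (fun s => (ω s).2.1),
          below t.val (fun s => (ω s).2.2))) = 0 := by
  have hw : ∀ ω, 0 ≤ iidW p n ω := fun ω => Finset.prod_nonneg fun s _ => hp.1 _
  -- the rectangle property of interactive protocols
  have rect : ∀ u v m : Fin n → XA × YA × ZA,
      (∀ k, Jx k u = Jx k v) → (∀ k, Jy k u = Jy k v) → (∀ k, Jz k u = Jz k v) →
      (fun s => (m s).1) = (fun s => (u s).1) →
      (fun s => (m s).2.1) = (fun s => (v s).2.1) →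
      (fun s => (m s).2.2) = (fun s => (u s).2.2) →
      ∀ N : ℕ, ∀ k : Fin K, k.val = N → Jx k m = Jx k u ∧ Jy k m = Jy k u ∧ Jz k m = Jz k u := by
    intro u v m ex ey ez hx hy hz N
    induction N using Nat.strong_induction_on with
    | _ N ih =>
      intro k hk
      have ax : ∀ j : Fin K, j.val < k.val → Jx j m = Jx j u :=
        fun j hj => (ih j.val (hk ▸ hj) j rfl).1
      have ay : ∀ j : Fin K, j.val < k.val → Jy j m = Jy j u :=
        fun j hj => (ih j.val (hk ▸ hj) j rfl).2.1
      have az : ∀ j : Fin K, j.val < k.val → Jz j m = Jz j u :=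
        fun j hj => (ih j.val (hk ▸ hj) j rfl).2.2
      have bx : Jx k m = Jx k u := by
        obtain ⟨f, hf⟩ := hJx k
        rw [hf m, hf u, hx]
        congr 1
        · funext j hj; exact ax j hj
        · funext j hj; exact ay j hj
        · funext j hj; exact az j hj
      have ax' : ∀ j : Fin K, j.val ≤ k.val → Jx j m = Jx j u := by
        intro j hj
        rcases hj.lt_or_eq with h | h
        · exact ax j h
        · rw [Fin.ext h]; exact bx
      have cy : Jy k m = Jy k u := by
        rw [ey]
        obtain ⟨f, hf⟩ := hJy k
        rw [hf m, hf v, hy]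
        congr 1
        · funext j hj; exact (ax' j hj).trans (ex j)
        · funext j hj; exact (ay j hj).trans (ey j)
        · funext j hj; exact (az j hj).trans (ez j)
      have ay' : ∀ j : Fin K, j.val ≤ k.val → Jy j m = Jy j u := by
        intro j hj
        rcases hj.lt_or_eq with h | h
        · exact ay j h
        · rw [Fin.ext h]; exact cy
      refine ⟨bx, cy, ?_⟩
      obtain ⟨f, hf⟩ := hJz k
      rw [hf m, hf u, hz]
      congr 1
      · funext j hj; exact ax' j hj
      · funext j hj; exact ay' j hj
      · funext j hj; exact az j hj
  intro t
  constructor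
  · refine IT.condMutInfo_zero_of_swap _ hw _ _ _ (mixCoord fun s => s.val ≤ t.val)
      (mixCoord_mixCoord _) (iidW_mixCoord p _) ?_ ?_ ?_
    · intro u v h
      simp only [Prod.mk.injEq, funext_iff] at h
      obtain ⟨h1, h2, h3, h4, h5, h6⟩ := h
      have gx : (fun s => (mixCoord (fun s : Fin n => s.val ≤ t.val) u v s).1)
          = (fun s => (u s).1) := by
        funext s
        by_cases hs : s.val ≤ t.val <;> simp [mixCoord, hs, h4]
      have gy : (fun s => (mixCoord (fun s : Fin n => s.val ≤ t.val) u v s).2.1)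
          = (fun s => (v s).2.1) := by
        funext s
        by_cases hs : s.val ≤ t.val
        · simp [mixCoord, hs]
        · have := h5 s
          simpa [mixCoord, hs, above, not_le.1 hs] using this
      have gz : (fun s => (mixCoord (fun s : Fin n => s.val ≤ t.val) u v s).2.2)
          = (fun s => (u s).2.2) := by
        funext s
        by_cases hs : s.val ≤ t.val
        · have := h6 s
          simpa [mixCoord, hs, below, Nat.lt_succ_of_le hs] using this.symm
        · simp [mixCoord, hs]
      have r := fun k => rect u v _ h1 h2 h3 gx gy gz _ k rfl
      simp only [Prod.mk.injEq]
      refine ⟨funext fun k => (r k).1, funext fun k => (r k).2.1, funext fun k => (r k).2.2,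
        gx, ?_, ?_⟩
      · rw [gy]; exact (funext h5).symm
      · rw [gz]
    · intro u v h
      funext s
      by_cases hs : s.val ≤ t.val
      · simp [above, not_lt.2 hs]
      · simp [above, mixCoord, hs]
    · intro u v h
      simp [mixCoord]
  · refine IT.condMutInfo_zero_of_swap _ hw _ _ _ (mixCoord fun s => t.val ≤ s.val)
      (mixCoord_mixCoord _) (iidW_mixCoord p _) ?_ ?_ ?_
    · intro u v h
      simp only [Prod.mk.injEq, funext_iff] at h
      obtain ⟨h1, h2, h3, h4, h5, h6⟩ := h
      have gx : (fun s => (mixCoord (fun s : Fin n => t.val ≤ s.val) u v s).1)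
          = (fun s => (v s).1) := by
        funext s
        by_cases hs : t.val ≤ s.val <;> simp [mixCoord, hs, h4]
      have gy : (fun s => (mixCoord (fun s : Fin n => t.val ≤ s.val) u v s).2.1)
          = (fun s => (u s).2.1) := by
        funext s
        by_cases hs : t.val ≤ s.val
        · have := h5 s
          simpa [mixCoord, hs, fromIdx] using this.symm
        · simp [mixCoord, hs]
      have gz : (fun s => (mixCoord (fun s : Fin n => t.val ≤ s.val) u v s).2.2)
          = (fun s => (v s).2.2) := by
        funext s
        by_cases hs : t.val ≤ s.val
        · simp [mixCoord, hs]
        · have := h6 s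
          simpa [mixCoord, hs, below, not_le.1 hs] using this
      have r := fun k => rect v u _ (fun k => (h1 k).symm) (fun k => (h2 k).symm)
        (fun k => (h3 k).symm) gx gy gz _ k rfl
      simp only [Prod.mk.injEq]
      refine ⟨funext fun k => (r k).1.trans (h1 k).symm,
        funext fun k => (r k).2.1.trans (h2 k).symm,
        funext fun k => (r k).2.2.trans (h3 k).symm, ?_, ?_, ?_⟩
      · rw [gx]; exact (funext h4).symm
      · rw [gy]
      · rw [gz]; exact (funext h6).symm
    · intro u v h
      funext s
      by_cases hs : t.val ≤ s.val
      · simp [below, not_lt.2 hs]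
      · simp [below, mixCoord, hs]
    · intro u v h
      simp [mixCoord]
end
end
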